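/- Let u,v ∈ S_n have separated descents at position k, and let w ∈ S_n. Then the structure constant c_{u,v}^w(t,y) equals the weighted sum Σ_{π∈PP(u,v,w)} wt(π) over all pipe puzzles for (u,v,w). -/

import Mathlib

open MvPolynomial

noncomputable section

namespace BPDPuzzle

/-- `x ⊖ y = (x - y)/(1 + β·y)`. -/
def ominus {K : Type*} [Field K] (β a b : K) : K := (a - b) / (1 + β * b)

/-- A permutation of `ℕ` lying in `S_∞`, i.e. fixing all sufficiently large integers. -/
def FinPerm (w : Equiv.Perm ℕ) : Prop := ∃ N : ℕ, ∀ j, N ≤ j → w j = j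

/-- A permutation of `ℕ` lying in `S_n` (0-based positions `0, …, n-1`). -/
def InSn (n : ℕ) (w : Equiv.Perm ℕ) : Prop := ∀ j, n ≤ j → w j = j

/-- Coxeter length: the number of inversions. -/
def len (w : Equiv.Perm ℕ) : ℕ := Set.ncard {p : ℕ × ℕ | p.1 < p.2 ∧ w p.2 < w p.1}

/-- The simple transposition `s_i`, exchanging the (0-based) positions `i` and `i+1`. -/
def sTr (i : ℕ) : Equiv.Perm ℕ := Equiv.swap i (i + 1)

/-- `u` and `v` have separated descents at position `k`, i.e.
`maxdes(u) ≤ k ≤ mindes(v)` (in 0-based conventions: `u` has no descent at any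
0-based position `≥ k` and `v` has no descent at any 0-based position `< k-1`). -/
def SepDesc (k : ℕ) (u v : Equiv.Perm ℕ) : Prop :=
  (∀ i, k ≤ i → u i ≤ u (i + 1)) ∧ (∀ i, i + 1 < k → v i ≤ v (i + 1))

/-- The longest element `n ⋯ 2 1` of `S_n`, extended by the identity. -/
def revPerm (n : ℕ) : Equiv.Perm ℕ where
  toFun j := if j < n then n - 1 - j else j
  invFun j := if j < n then n - 1 - j else j
  left_inv j := by dsimp only; split_ifs <;> omega
  right_inv j := by dsimp only; split_ifs <;> omega

/-- Exchange the values of a valuation at the indices `i` and `i+1`. -/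
def swapVal {K : Type*} (t : ℕ → K) (i : ℕ) : ℕ → K :=
  fun j => if j = i then t (i + 1) else if j = i + 1 then t i else t j

/-- The defining properties of the family of double Grothendieck polynomials
`𝔊_w(x, t)`, viewed as a family of polynomials in the `x`-variables depending on
a valuation `t` of the second set of variables:  the initial condition
`𝔊_{n⋯21}(x,t) = ∏_{i+j≤n} (x_i ⊖ t_j)` together with the Demazure recursion
`π_i 𝔊_w = 𝔊_{w s_i}` whenever `w(i) > w(i+1)` (the latter written with the
denominator `x_i - x_{i+1}` cleared). -/
def GrothFamily {K : Type*} [Field K] (β : K)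
    (G : (ℕ → K) → Equiv.Perm ℕ → MvPolynomial ℕ K) : Prop :=
  ∀ t : ℕ → K, (∀ j, 1 + β * t j ≠ 0) →
    (∀ n : ℕ, G t (revPerm n) =
      ∏ i ∈ Finset.range n, ∏ j ∈ Finset.range (n - 1 - i),
        C ((1 + β * t j)⁻¹) * (X i - C (t j))) ∧
    (∀ (w : Equiv.Perm ℕ) (i : ℕ), w (i + 1) < w i →
      (X i - X (i + 1)) * G t (w * sTr i) =
        (1 + C β * X (i + 1)) * G t w
          - (1 + C β * X i) * rename ⇑(Equiv.swap i (i + 1)) (G t w))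

/-- The defining property of the structure constants `c_{u,v}^w(t,y)`:
`𝔊_u(x,y) · 𝔊_v(x,t) = Σ_w c_{u,v}^w(t,y) · 𝔊_w(x,t)`, the (finitely supported)
sum ranging over the permutations `w ∈ S_∞`. -/
def StructConsts {K : Type*} [Field K] (β : K)
    (G : (ℕ → K) → Equiv.Perm ℕ → MvPolynomial ℕ K)
    (c : (ℕ → K) → (ℕ → K) → Equiv.Perm ℕ → Equiv.Perm ℕ → Equiv.Perm ℕ → K) : Prop :=
  ∀ t y : ℕ → K, (∀ j, 1 + β * t j ≠ 0) → (∀ j, 1 + β * y j ≠ 0) →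
    ∀ u v : Equiv.Perm ℕ, FinPerm u → FinPerm v →
      {w : Equiv.Perm ℕ | c t y u v w ≠ 0}.Finite ∧
      (∀ w, ¬ FinPerm w → c t y u v w = 0) ∧
      G y u * G t v = ∑ᶠ w : Equiv.Perm ℕ, C (c t y u v w) * G t w

/-! ### The lattice model / pipe puzzles -/

/-- A state of the `n × n` lattice model: labels in `{0, …, n}` on all horizontal
and vertical (half-)edges.  `sst.1 i j` is the `j`-th horizontal (half-)edge of row
`i` (`j = 0` being the left boundary and `j = n` the right boundary), and
`sst.2 i j` is the `i`-th vertical (half-)edge of column `j` (`i = 0` the top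
boundary, `i = n` the bottom boundary). -/
abbrev GridState (n : ℕ) : Type :=
  (Fin n → Fin (n + 1) → Fin (n + 1)) × (Fin (n + 1) → Fin n → Fin (n + 1))

/-- The label on the north edge of the tile in row `i`, column `j`. -/
def labN {n : ℕ} (sst : GridState n) (i j : Fin n) : ℕ := (sst.2 i.castSucc j : ℕ)
/-- The label on the east edge of the tile in row `i`, column `j`. -/
def labE {n : ℕ} (sst : GridState n) (i j : Fin n) : ℕ := (sst.1 i j.succ : ℕ)
/-- The label on the west edge of the tile in row `i`, column `j`. -/
def labW {n : ℕ} (sst : GridState n) (i j : Fin n) : ℕ := (sst.1 i j.castSucc : ℕ)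
/-- The label on the south edge of the tile in row `i`, column `j`. -/
def labS {n : ℕ} (sst : GridState n) (i j : Fin n) : ℕ := (sst.2 i.succ j : ℕ)

/-- Boundary label `κ_u` on the right side (0-based row `i`, 1-based pipe labels). -/
def kappaLab (k : ℕ) (u : Equiv.Perm ℕ) (i : ℕ) : ℕ :=
  if u⁻¹ i < k then u⁻¹ i + 1 else 0

/-- Boundary label `θ_v` on the top side (0-based column `j`, 1-based pipe labels). -/
def thetaLab (k : ℕ) (v : Equiv.Perm ℕ) (j : ℕ) : ℕ :=
  if k ≤ v⁻¹ j then v⁻¹ j + 1 else 0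

/-- Boundary label `η_w` on the bottom side (0-based column `j`, 1-based pipe labels). -/
def etaLab (w : Equiv.Perm ℕ) (j : ℕ) : ℕ := w⁻¹ j + 1

/-- The boundary condition for pipe puzzles for `(u, v, w)`: left edges all `0`,
right edges `κ_u`, top edges `θ_v`, bottom edges `η_w`. -/
def BoundaryCond (n k : ℕ) (u v w : Equiv.Perm ℕ) (sst : GridState n) : Prop :=
  (∀ i : Fin n, (sst.1 i 0 : ℕ) = 0) ∧
  (∀ i : Fin n, (sst.1 i (Fin.last n) : ℕ) = kappaLab k u (i : ℕ)) ∧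
  (∀ j : Fin n, (sst.2 0 j : ℕ) = thetaLab k v (j : ℕ)) ∧
  (∀ j : Fin n, (sst.2 (Fin.last n) j : ℕ) = etaLab w (j : ℕ))

/-- The admissible local configurations (tiles) of a pipe puzzle, in terms of the
four edge labels `N, E, W, S` around a tile:  the empty tile, the vertical pipe,
the horizontal pipe, the crossing (with the horizontal pipe carrying the smaller
label), the two elbows `⌟` and `⌐` (labels `≤ k` coming from the right side,
labels `> k` from the top side), and the bumping tiles (with the stated label
restrictions). -/
def LAdm (k N E W S : ℕ) : Prop :=
  (N = 0 ∧ E = 0 ∧ W = 0 ∧ S = 0) ∨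
  (E = 0 ∧ W = 0 ∧ 0 < N ∧ N = S) ∨
  (N = 0 ∧ S = 0 ∧ 0 < E ∧ E = W) ∨
  (0 < E ∧ E = W ∧ E < N ∧ N = S) ∨
  (E = 0 ∧ S = 0 ∧ 0 < N ∧ N = W ∧ N ≤ k) ∨
  (E = 0 ∧ S = 0 ∧ N = W ∧ k < N) ∨
  (N = 0 ∧ W = 0 ∧ 0 < E ∧ E = S ∧ E ≤ k) ∨
  (N = 0 ∧ W = 0 ∧ E = S ∧ k < E) ∨
  (0 < E ∧ E = S ∧ E < N ∧ N = W ∧ N ≤ k) ∨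
  (k < E ∧ E = S ∧ E < N ∧ N = W) ∨
  (0 < N ∧ N = W ∧ N ≤ k ∧ E = S ∧ k < E)

/-- The admissible local configurations of a Schubert pipe puzzle (no bumping
tiles; crossings have the horizontal pipe carrying the smaller label). -/
def LAdm0 (N E W S : ℕ) : Prop :=
  (N = 0 ∧ E = 0 ∧ W = 0 ∧ S = 0) ∨
  (E = 0 ∧ W = 0 ∧ 0 < N ∧ N = S) ∨
  (N = 0 ∧ S = 0 ∧ 0 < E ∧ E = W) ∨
  (0 < E ∧ E = W ∧ E < N ∧ N = S) ∨
  (E = 0 ∧ S = 0 ∧ 0 < N ∧ N = W) ∨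
  (N = 0 ∧ W = 0 ∧ 0 < E ∧ E = S)

/-- The vertex weight `L(x; N, E, W, S)` of the lattice model (equivalently, the
weight of the corresponding pipe-puzzle tile), with spectral parameter `x`. -/
def Lwt {K : Type*} [Field K] (β : K) (k : ℕ) (x : K) (N E W S : ℕ) : K :=
  if N = 0 ∧ E = 0 ∧ W = 0 ∧ S = 0 then x
  else if E = 0 ∧ W = 0 ∧ 0 < N ∧ N = S then 1
  else if N = 0 ∧ S = 0 ∧ 0 < E ∧ E = W then 1
  else if 0 < E ∧ E = W ∧ E < N ∧ N = S then 1
  else if E = 0 ∧ S = 0 ∧ 0 < N ∧ N = W ∧ N ≤ k then 1 + β * x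
  else if E = 0 ∧ S = 0 ∧ N = W ∧ k < N then 1
  else if N = 0 ∧ W = 0 ∧ 0 < E ∧ E = S ∧ E ≤ k then 1
  else if N = 0 ∧ W = 0 ∧ E = S ∧ k < E then 1 + β * x
  else if 0 < E ∧ E = S ∧ E < N ∧ N = W ∧ N ≤ k then β
  else if k < E ∧ E = S ∧ E < N ∧ N = W then β
  else if 0 < N ∧ N = W ∧ N ≤ k ∧ E = S ∧ k < E then β * (1 + β * x)
  else 0

/-- The set of pipe puzzles for `(u, v, w)` (with separated-descent parameter `k`),
encoded as admissible states of the lattice model. -/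
def PP (n k : ℕ) (u v w : Equiv.Perm ℕ) : Set (GridState n) :=
  {sst | BoundaryCond n k u v w sst ∧
    ∀ i j : Fin n, LAdm k (labN sst i j) (labE sst i j) (labW sst i j) (labS sst i j)}

/-- The set of Schubert pipe puzzles for `(u, v, w)`. -/
def PP0 (n k : ℕ) (u v w : Equiv.Perm ℕ) : Set (GridState n) :=
  {sst | BoundaryCond n k u v w sst ∧
    ∀ i j : Fin n, LAdm0 (labN sst i j) (labE sst i j) (labW sst i j) (labS sst i j)}

/-- The weight `wt(π)` of a pipe puzzle: the product over all tiles, the tile in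
row `i` and column `j` having spectral parameter `t_j ⊖ y_i`. -/
def stateWt {K : Type*} [Field K] (β : K) (k : ℕ) (t y : ℕ → K) {n : ℕ}
    (sst : GridState n) : K :=
  ∏ i : Fin n, ∏ j : Fin n,
    Lwt β k (ominus β (t (j : ℕ)) (y (i : ℕ)))
      (labN sst i j) (labE sst i j) (labW sst i j) (labS sst i j)

/-- The Schubert weight `wt₀(π)`: the product of `t_j - y_i` over the positions
`(i, j)` of the empty tiles. -/
def stateWt0 {K : Type*} [Field K] (t y : ℕ → K) {n : ℕ} (sst : GridState n) : K :=
  ∏ i : Fin n, ∏ j : Fin n,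
    if labN sst i j = 0 ∧ labE sst i j = 0 ∧ labW sst i j = 0 ∧ labS sst i j = 0
    then t (j : ℕ) - y (i : ℕ) else 1

/-! ### Tiles as operators -/

/-- Weight of a tile in which both pipes go straight; `N` and `E` are the incoming labels. -/
def passWt {R : Type*} [CommRing R] (x : R) (N E : ℕ) : R :=
  if N = 0 ∧ E = 0 then x else if N = 0 ∨ E < N then 1 else 0

/-- Weight of a tile in which both pipes turn; `kd a` says that the pipe `a` entered from the
right. -/
def turnWt {R : Type*} [CommRing R] (kd : ℕ → Bool) (β x : R) (N E : ℕ) : R :=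
  if E < N then
    if E = 0 then (if kd N then 1 + β * x else 1) else if kd N = kd E then β else 0
  else if N = 0 then
    if E = 0 then 0 else (if kd E then 1 else 1 + β * x)
  else if kd N = true ∧ kd E = false then β * (1 + β * x) else 0

/-- Diagonal coefficient of the exchange operator of two columns. -/
def colDiag {R : Type*} [CommRing R] (kd : ℕ → Bool) (β t₁ t₂ : R) (a b : ℕ) : R :=
  if b < a then
    if b = 0 ∧ kd a = true then 1 + β * t₁ else 1 + β * t₂
  else if a = 0 ∧ b ≠ 0 ∧ kd b = true then 1 + β * t₂ else 1 + β * t₁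

/-- Off-diagonal coefficient of the exchange operator of two columns. -/
def colOff {R : Type*} [CommRing R] (t₁ t₂ : R) (a b : ℕ) : R :=
  if b < a then t₂ - t₁ else 0

/-- `a` is larger than `b` when `0` is regarded as larger than all other labels. -/
def rowGt (a b : ℕ) : Prop := b ≠ 0 ∧ (a = 0 ∨ b < a)

instance (a b : ℕ) : Decidable (rowGt a b) := inferInstanceAs (Decidable (_ ∧ _))

/-- Diagonal coefficient of the exchange operator of two rows. -/
def rowDiag {R : Type*} [CommRing R] (β r₁ r₂ : R) (a b : ℕ) : R :=
  if rowGt a b then 1 + β * r₂ else 1 + β * r₁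

/-- Off-diagonal coefficient of the exchange operator of two rows. -/
def rowOff {R : Type*} [CommRing R] (r₁ r₂ : R) (a b : ℕ) : R :=
  if rowGt a b then r₂ - r₁ else 0

/-- The formal group law `x ⊕ y = x + y + βxy`. -/
def oplus {R : Type*} [CommRing R] (β x y : R) : R := x + y + β * x * y

lemma row_local {R : Type*} [CommRing R] (β t r₁ r₂ : R) (φ : ℕ → ℕ → ℕ → R) (E₁ E₂ N : ℕ) :
    let x₁ := oplus β t r₁
    let x₂ := oplus β t r₂
    let T₁ := fun (x : R) (φ : ℕ → ℕ → ℕ → R) (a b N : ℕ) =>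
      passWt x N a * φ a b N + turnWt (fun _ => true) β x N a * φ N b a
    let T₂ := fun (x : R) (φ : ℕ → ℕ → ℕ → R) (a b N : ℕ) =>
      passWt x N b * φ a b N + turnWt (fun _ => true) β x N b * φ a N b
    let Q := fun (φ : ℕ → ℕ → ℕ → R) (a b N : ℕ) =>
      rowDiag β r₁ r₂ a b * φ a b N + rowOff r₁ r₂ a b * φ b a N
    Q (T₁ x₁ (T₂ x₂ φ)) E₁ E₂ N = T₁ x₂ (T₂ x₁ (Q φ)) E₁ E₂ N := by
  intro x₁ x₂ T₁ T₂ Q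
  simp only [T₁, T₂, Q, x₁, x₂, oplus, passWt, turnWt, rowDiag, rowOff, rowGt]
  rcases Nat.eq_zero_or_pos E₁ with h1 | h1 <;> rcases Nat.eq_zero_or_pos E₂ with h2 | h2 <;>
  rcases Nat.eq_zero_or_pos N with h3 | h3 <;>
  rcases lt_trichotomy E₁ E₂ with h4 | h4 | h4 <;>
  rcases lt_trichotomy E₁ N with h5 | h5 | h5 <;>
  rcases lt_trichotomy E₂ N with h6 | h6 | h6 <;>
  first
  | omega
  | (try subst h1
     try subst h2
     try subst h3
     try subst h4
     try subst h5
     try subst h6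
     simp [*, Nat.pos_iff_ne_zero.mp, Nat.not_lt.mpr, le_of_lt, ne_of_gt]
     try ring)

set_option maxHeartbeats 4000000 in
lemma col_local {R : Type*} [CommRing R] (kd : ℕ → Bool)
    (hkd : ∀ a b, a ≤ b → kd b = true → kd a = true) (β t₁ t₂ r : R)
    (φ : ℕ → ℕ → ℕ → R) (N₁ N₂ e : ℕ) :
    let x₁ := oplus β t₁ r
    let x₂ := oplus β t₂ r
    let Ta := fun (x : R) (φ : ℕ → ℕ → ℕ → R) (a b e : ℕ) =>
      passWt x a e * φ a b e + turnWt kd β x a e * φ e b a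
    let Tb := fun (x : R) (φ : ℕ → ℕ → ℕ → R) (a b e : ℕ) =>
      passWt x b e * φ a b e + turnWt kd β x b e * φ a e b
    let Q := fun (φ : ℕ → ℕ → ℕ → R) (a b e : ℕ) =>
      colDiag kd β t₁ t₂ a b * φ a b e + colOff t₁ t₂ a b * φ b a e
    Q (Tb x₁ (Ta x₂ φ)) N₁ N₂ e = Tb x₂ (Ta x₁ (Q φ)) N₁ N₂ e := by
  intro x₁ x₂ Ta Tb Q
  have h12 := hkd N₁ N₂
  have h21 := hkd N₂ N₁
  have h13 := hkd N₁ e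
  have h31 := hkd e N₁
  have h23 := hkd N₂ e
  have h32 := hkd e N₂
  simp only [Ta, Tb, Q, x₁, x₂, oplus, passWt, turnWt, colDiag, colOff]
  clear_value Ta Tb Q x₁ x₂
  clear Ta Tb Q x₁ x₂ hkd
  rcases Bool.eq_false_or_eq_true (kd N₁) with k1 | k1 <;>
  rcases Bool.eq_false_or_eq_true (kd N₂) with k2 | k2 <;>
  rcases Bool.eq_false_or_eq_true (kd e) with k3 | k3 <;>
  simp only [k1, k2, k3, imp_true_iff, imp_false, not_true_eq_false, not_le, reduceCtorEq,
    and_true, and_false, ite_true, ite_false, not_false_eq_true]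
    at h12 h21 h13 h31 h23 h32 ⊢ <;>
  clear k1 k2 k3 kd <;>
  rcases Nat.eq_zero_or_pos N₁ with h1 | h1 <;> rcases Nat.eq_zero_or_pos N₂ with h2 | h2 <;>
  rcases Nat.eq_zero_or_pos e with h3 | h3 <;>
  first
  | omega
  | (rcases lt_trichotomy N₁ N₂ with h4 | h4 | h4 <;>
     rcases lt_trichotomy N₁ e with h5 | h5 | h5 <;>
     rcases lt_trichotomy N₂ e with h6 | h6 | h6 <;>
     first
     | omega
     | (clear h12 h21 h13 h31 h23 h32
        try subst h1
        try subst h2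
        try subst h3
        try subst h4
        try subst h5
        try subst h6
        simp [*, Nat.pos_iff_ne_zero.mp, Nat.not_lt.mpr, le_of_lt]
        try ring))

/-- Labels on the horizontal lines (`Sum.inl i`) and vertical lines (`Sum.inr j`). -/
abbrev Lines := ℕ ⊕ ℕ → ℕ

/-- The operator on functions of line labels which keeps the labels of the lines `p` and `q` with
weight `A` and exchanges them with weight `B`. -/
def lineOp {R : Type*} [CommRing R] (A B : ℕ → ℕ → R) (p q : ℕ ⊕ ℕ) :
    Module.End R (Lines → R) where
  toFun φ f := A (f p) (f q) * φ f + B (f p) (f q) * φ (f ∘ Equiv.swap p q)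
  map_add' φ ψ := by ext f; simp only [Pi.add_apply]; ring
  map_smul' a φ := by ext f; simp only [Pi.smul_apply, smul_eq_mul, RingHom.id_apply]; ring

lemma lineOp_apply {R : Type*} [CommRing R] (A B : ℕ → ℕ → R) (p q : ℕ ⊕ ℕ) (φ : Lines → R)
    (f : Lines) : lineOp A B p q φ f =
      A (f p) (f q) * φ f + B (f p) (f q) * φ (f ∘ Equiv.swap p q) := rfl

lemma lineOp_commute {R : Type*} [CommRing R] (A B A' B' : ℕ → ℕ → R) {p q p' q' : ℕ ⊕ ℕ}
    (h1 : p ≠ p') (h2 : p ≠ q') (h3 : q ≠ p') (h4 : q ≠ q') :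
    Commute (lineOp A B p q) (lineOp A' B' p' q') := by
  ext φ f
  have e : (f ∘ Equiv.swap p q) ∘ Equiv.swap p' q' = (f ∘ Equiv.swap p' q') ∘ Equiv.swap p q := by
    have : Equiv.Perm.Disjoint (Equiv.swap p q) (Equiv.swap p' q') := by
      intro z
      by_cases hp : z = p
      · right; subst hp; exact Equiv.swap_apply_of_ne_of_ne h1 h2
      by_cases hq : z = q
      · right; subst hq; exact Equiv.swap_apply_of_ne_of_ne h3 h4
      · left; exact Equiv.swap_apply_of_ne_of_ne hp hq
    ext z
    exact congrArg f (DFunLike.congr_fun this.commute.eq z)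
  simp only [Module.End.mul_apply, lineOp_apply, e, Function.comp_apply,
    Equiv.swap_apply_of_ne_of_ne h1 h2, Equiv.swap_apply_of_ne_of_ne h3 h4,
    Equiv.swap_apply_of_ne_of_ne h1.symm h3.symm, Equiv.swap_apply_of_ne_of_ne h2.symm h4.symm]
  ring

/-- Replace the labels of the three lines `p`, `q`, `l`. -/
def assign (p q l : ℕ ⊕ ℕ) (f : Lines) (a b c : ℕ) : Lines := fun z =>
  if z = p then a else if z = q then b else if z = l then c else f z

lemma assign_self (p q l : ℕ ⊕ ℕ) (f : Lines) : assign p q l f (f p) (f q) (f l) = f := by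
  ext z; unfold assign; split_ifs <;> simp_all

section
variable {R : Type*} [CommRing R] (A B : ℕ → ℕ → R) {p q l : ℕ ⊕ ℕ}

lemma lineOp_assign_pq (hpq : p ≠ q) (hpl : p ≠ l) (hql : q ≠ l) (φ : Lines → R)
    (f : Lines) (a b c : ℕ) : lineOp A B p q φ (assign p q l f a b c) =
    A a b * φ (assign p q l f a b c) + B a b * φ (assign p q l f b a c) := by
  have e : assign p q l f a b c ∘ Equiv.swap p q = assign p q l f b a c := by
    ext z; simp only [assign, Function.comp_apply, Equiv.swap_apply_def]
    split_ifs <;> simp_all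
  rw [lineOp_apply, e]; simp [assign, hpq.symm]

lemma lineOp_assign_lp (hpq : p ≠ q) (hpl : p ≠ l) (hql : q ≠ l) (φ : Lines → R)
    (f : Lines) (a b c : ℕ) : lineOp A B l p φ (assign p q l f a b c) =
    A c a * φ (assign p q l f a b c) + B c a * φ (assign p q l f c b a) := by
  have e : assign p q l f a b c ∘ Equiv.swap l p = assign p q l f c b a := by
    ext z; simp only [assign, Function.comp_apply, Equiv.swap_apply_def]
    split_ifs <;> simp_all
  rw [lineOp_apply, e]; simp [assign, hpl.symm, hql.symm]

lemma lineOp_assign_lq (hpq : p ≠ q) (hpl : p ≠ l) (hql : q ≠ l) (φ : Lines → R)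
    (f : Lines) (a b c : ℕ) : lineOp A B l q φ (assign p q l f a b c) =
    A c b * φ (assign p q l f a b c) + B c b * φ (assign p q l f a c b) := by
  have e : assign p q l f a b c ∘ Equiv.swap l q = assign p q l f a c b := by
    ext z; simp only [assign, Function.comp_apply, Equiv.swap_apply_def]
    split_ifs <;> simp_all
  rw [lineOp_apply, e]; simp [assign, hql.symm, hpl.symm, hpq.symm]

lemma lineOp_assign_pl (hpq : p ≠ q) (hpl : p ≠ l) (hql : q ≠ l) (φ : Lines → R)
    (f : Lines) (a b c : ℕ) : lineOp A B p l φ (assign p q l f a b c) =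
    A a c * φ (assign p q l f a b c) + B a c * φ (assign p q l f c b a) := by
  have e : assign p q l f a b c ∘ Equiv.swap p l = assign p q l f c b a := by
    ext z; simp only [assign, Function.comp_apply, Equiv.swap_apply_def]
    split_ifs <;> simp_all
  rw [lineOp_apply, e]; simp [assign, hpl.symm, hql.symm]

lemma lineOp_assign_ql (hpq : p ≠ q) (hpl : p ≠ l) (hql : q ≠ l) (φ : Lines → R)
    (f : Lines) (a b c : ℕ) : lineOp A B q l φ (assign p q l f a b c) =
    A b c * φ (assign p q l f a b c) + B b c * φ (assign p q l f a c b) := by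
  have e : assign p q l f a b c ∘ Equiv.swap q l = assign p q l f a c b := by
    ext z; simp only [assign, Function.comp_apply, Equiv.swap_apply_def]
    split_ifs <;> simp_all
  rw [lineOp_apply, e]; simp [assign, hql.symm, hpl.symm, hpq.symm]

end

/-- The tile in row `i` and column `j`. -/
def tileOp {R : Type*} [CommRing R] (kd : ℕ → Bool) (β x : R) (i j : ℕ) :
    Module.End R (Lines → R) :=
  lineOp (passWt x) (turnWt kd β x) (Sum.inr j) (Sum.inl i)

/-- The first `m` tiles of column `j`. -/
def colOp {R : Type*} [CommRing R] (kd : ℕ → Bool) (β : R) (t r : ℕ → R) (j : ℕ) :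
    ℕ → Module.End R (Lines → R)
  | 0 => 1
  | m + 1 => colOp kd β t r j m * tileOp kd β (oplus β (t j) (r m)) m j

/-- The grid with `m` rows and a given number of columns. -/
def gridOp {R : Type*} [CommRing R] (kd : ℕ → Bool) (β : R) (t r : ℕ → R) (m : ℕ) :
    ℕ → Module.End R (Lines → R)
  | 0 => 1
  | c + 1 => colOp kd β t r c m * gridOp kd β t r m c

/-- Exchange operator for the columns `j` and `j + 1`. -/
def colEx {R : Type*} [CommRing R] (kd : ℕ → Bool) (β t₁ t₂ : R) (j : ℕ) :
    Module.End R (Lines → R) :=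
  lineOp (colDiag kd β t₁ t₂) (colOff t₁ t₂) (Sum.inr j) (Sum.inr (j + 1))

/-- Exchange operator for the rows `i` and `i + 1`. -/
def rowEx {R : Type*} [CommRing R] (β r₁ r₂ : R) (i : ℕ) : Module.End R (Lines → R) :=
  lineOp (rowDiag β r₁ r₂) (rowOff r₁ r₂) (Sum.inl i) (Sum.inl (i + 1))

section
variable {R : Type*} [CommRing R]

lemma colEx_tile (kd : ℕ → Bool)
    (hkd : ∀ a b, a ≤ b → kd b = true → kd a = true) (β t₁ t₂ r : R) (i j : ℕ) :
    colEx kd β t₁ t₂ j * (tileOp kd β (oplus β t₁ r) i (j + 1) * tileOp kd β (oplus β t₂ r) i j) =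
      tileOp kd β (oplus β t₂ r) i (j + 1) * tileOp kd β (oplus β t₁ r) i j *
        colEx kd β t₁ t₂ j := by
  ext φ f
  have h1 : (Sum.inr j : ℕ ⊕ ℕ) ≠ Sum.inr (j + 1) := by simp
  have h2 : (Sum.inr j : ℕ ⊕ ℕ) ≠ Sum.inl i := by simp
  have h3 : (Sum.inr (j + 1) : ℕ ⊕ ℕ) ≠ Sum.inl i := by simp
  have key := col_local kd hkd β t₁ t₂ r
    (fun a b c => φ (assign (Sum.inr j) (Sum.inr (j + 1)) (Sum.inl i) f a b c))
    (f (Sum.inr j)) (f (Sum.inr (j + 1))) (f (Sum.inl i))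
  rw [← assign_self (Sum.inr j) (Sum.inr (j + 1)) (Sum.inl i) f]
  simp only [Module.End.mul_apply, colEx, tileOp, lineOp_assign_pq _ _ h1 h2 h3,
    lineOp_assign_pl _ _ h1 h2 h3, lineOp_assign_ql _ _ h1 h2 h3]
  exact key

lemma rowEx_tile (β t r₁ r₂ : R) (i j : ℕ) :
    rowEx β r₁ r₂ i * (tileOp (fun _ => true) β (oplus β t r₁) i j *
        tileOp (fun _ => true) β (oplus β t r₂) (i + 1) j) =
      tileOp (fun _ => true) β (oplus β t r₂) i j *
        tileOp (fun _ => true) β (oplus β t r₁) (i + 1) j * rowEx β r₁ r₂ i := by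
  ext φ f
  have h1 : (Sum.inl i : ℕ ⊕ ℕ) ≠ Sum.inl (i + 1) := by simp
  have h2 : (Sum.inl i : ℕ ⊕ ℕ) ≠ Sum.inr j := by simp
  have h3 : (Sum.inl (i + 1) : ℕ ⊕ ℕ) ≠ Sum.inr j := by simp
  have key := row_local β t r₁ r₂
    (fun a b c => φ (assign (Sum.inl i) (Sum.inl (i + 1)) (Sum.inr j) f a b c))
    (f (Sum.inl i)) (f (Sum.inl (i + 1))) (f (Sum.inr j))
  rw [← assign_self (Sum.inl i) (Sum.inl (i + 1)) (Sum.inr j) f]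
  simp only [Module.End.mul_apply, rowEx, tileOp, lineOp_assign_pq _ _ h1 h2 h3,
    lineOp_assign_lp _ _ h1 h2 h3, lineOp_assign_lq _ _ h1 h2 h3]
  exact key

lemma tileOp_commute (kd : ℕ → Bool) (β x x' : R) {i j i' j' : ℕ} (hi : i ≠ i') (hj : j ≠ j') :
    Commute (tileOp kd β x i j) (tileOp kd β x' i' j') :=
  lineOp_commute _ _ _ _ (by simpa) (by simp) (by simp) (by simpa)

lemma colOp_congr (kd : ℕ → Bool) (β : R) {t r t' r' : ℕ → R} {j : ℕ} {m : ℕ} (ht : t j = t' j)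
    (hr : ∀ i < m, r i = r' i) : colOp kd β t r j m = colOp kd β t' r' j m := by
  induction m with
  | zero => rfl
  | succ m ih => simp only [colOp, ih fun i hi => hr i (by omega), ht, hr m (by omega)]

lemma gridOp_congr (kd : ℕ → Bool) (β : R) {t r t' r' : ℕ → R} {m c : ℕ} (ht : ∀ j < c, t j = t' j)
    (hr : ∀ i < m, r i = r' i) : gridOp kd β t r m c = gridOp kd β t' r' m c := by
  induction c with
  | zero => rfl
  | succ c ih =>
    simp only [gridOp, ih fun i hi => ht i (by omega), colOp_congr kd β (ht c (by omega)) hr]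

lemma tileOp_commute_colOp (kd : ℕ → Bool) (β x : R) (t r : ℕ → R) {i j j' m : ℕ} (hi : m ≤ i)
    (hj : j ≠ j') : Commute (tileOp kd β x i j) (colOp kd β t r j' m) := by
  induction m with
  | zero => exact Commute.one_right _
  | succ m ih =>
    exact (ih (by omega)).mul_right (tileOp_commute kd β _ _ (by omega) hj)

lemma colEx_colOp (kd : ℕ → Bool) (hkd : ∀ a b, a ≤ b → kd b = true → kd a = true) (β : R)
    (t r : ℕ → R) (j m : ℕ) :
    colEx kd β (t j) (t (j + 1)) j *
        (colOp kd β (t ∘ sTr j) r (j + 1) m * colOp kd β (t ∘ sTr j) r j m) =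
      colOp kd β t r (j + 1) m * colOp kd β t r j m * colEx kd β (t j) (t (j + 1)) j := by
  induction m with
  | zero => simp [colOp]
  | succ m ih =>
    have e : ∀ t' : ℕ → R, colOp kd β t' r (j + 1) (m + 1) * colOp kd β t' r j (m + 1) =
        colOp kd β t' r (j + 1) m * colOp kd β t' r j m *
          (tileOp kd β (oplus β (t' (j + 1)) (r m)) m (j + 1) *
            tileOp kd β (oplus β (t' j) (r m)) m j) := by
      intro t'
      have h := tileOp_commute_colOp kd β (oplus β (t' (j + 1)) (r m)) t' r (le_refl m)
        (show j + 1 ≠ j by omega)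
      simp only [colOp, mul_assoc]
      rw [← mul_assoc (tileOp _ _ _ _ _) (colOp _ _ _ _ _ _), h.eq]
      simp only [mul_assoc]
    rw [e, e, ← mul_assoc, ih, mul_assoc]
    have h1 : (t ∘ sTr j) (j + 1) = t j := by simp [sTr]
    have h2 : (t ∘ sTr j) j = t (j + 1) := by simp [sTr]
    rw [h1, h2, colEx_tile kd hkd]
    simp only [mul_assoc]

lemma colEx_commute_colOp (kd : ℕ → Bool) (β t₁ t₂ : R) (t r : ℕ → R) {j j' : ℕ} (m : ℕ)
    (h : j' ≠ j) (h' : j' ≠ j + 1) : Commute (colEx kd β t₁ t₂ j) (colOp kd β t r j' m) := by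
  induction m with
  | zero => exact Commute.one_right _
  | succ m ih =>
    exact ih.mul_right (lineOp_commute _ _ _ _ (by simpa using h.symm) (by simp)
      (by simpa using h'.symm) (by simp))

lemma colEx_commute_gridOp (kd : ℕ → Bool) (β t₁ t₂ : R) (t r : ℕ → R) {j c : ℕ} (m : ℕ)
    (h : c ≤ j) : Commute (colEx kd β t₁ t₂ j) (gridOp kd β t r m c) := by
  induction c with
  | zero => exact Commute.one_right _
  | succ c ih =>
    exact (colEx_commute_colOp kd β _ _ _ _ _ (by omega) (by omega)).mul_right (ih (by omega))

lemma sTr_apply_ne {i j : ℕ} (h : j ≠ i) (h' : j ≠ i + 1) : sTr i j = j :=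
  Equiv.swap_apply_of_ne_of_ne h h'

lemma colEx_gridOp (kd : ℕ → Bool) (hkd : ∀ a b, a ≤ b → kd b = true → kd a = true) (β : R)
    (t r : ℕ → R) (m : ℕ) {j c : ℕ} (hj : j + 1 < c) :
    colEx kd β (t j) (t (j + 1)) j * gridOp kd β (t ∘ sTr j) r m c =
      gridOp kd β t r m c * colEx kd β (t j) (t (j + 1)) j := by
  induction c, hj using Nat.le_induction with
  | base =>
    have h := colEx_commute_gridOp kd β (t j) (t (j + 1)) t r m (le_refl j)
    have e : gridOp kd β (t ∘ sTr j) r m j = gridOp kd β t r m j :=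
      gridOp_congr kd β (fun i hi => by
        simp only [Function.comp_apply, sTr_apply_ne (show i ≠ j by omega) (by omega)])
        fun _ _ => rfl
    simp only [gridOp, e]
    rw [← mul_assoc (colOp _ _ _ _ _ _), ← mul_assoc (colEx _ _ _ _ _), colEx_colOp kd hkd,
      mul_assoc, h.eq]
    simp only [mul_assoc]
  | succ c hc ih =>
    have hc' : j + 1 < c := hc
    have e : colOp kd β (t ∘ sTr j) r c m = colOp kd β t r c m :=
      colOp_congr kd β (by
        simp only [Function.comp_apply, sTr_apply_ne (show c ≠ j by omega) (by omega)])
        fun _ _ => rfl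
    have h := colEx_commute_colOp kd β (t j) (t (j + 1)) t r m (show c ≠ j by omega)
      (show c ≠ j + 1 by omega)
    simp only [gridOp, e]
    rw [← mul_assoc, h.eq, mul_assoc, ih, mul_assoc]

lemma rowEx_commute_colOp (kd : ℕ → Bool) (β r₁ r₂ : R) (t r : ℕ → R) {i j m : ℕ}
    (h : m ≤ i) : Commute (rowEx β r₁ r₂ i) (colOp kd β t r j m) := by
  induction m with
  | zero => exact Commute.one_right _
  | succ m ih =>
    exact (ih (by omega)).mul_right (lineOp_commute _ _ _ _ (by simp) (by simp; omega) (by simp)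
      (by simp; omega))

lemma rowEx_colOp (β : R) (t r : ℕ → R) (j : ℕ) {i m : ℕ} (hi : i + 1 < m) :
    rowEx β (r i) (r (i + 1)) i * colOp (fun _ => true) β t r j m =
      colOp (fun _ => true) β t (r ∘ sTr i) j m * rowEx β (r i) (r (i + 1)) i := by
  induction m, hi using Nat.le_induction with
  | base =>
    have h := rowEx_commute_colOp (fun _ => true) β (r i) (r (i + 1)) t r (j := j) (le_refl i)
    have e : colOp (fun _ => true) β t (r ∘ sTr i) j i = colOp (fun _ => true) β t r j i :=
      colOp_congr _ β rfl (fun l hl => by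
        simp only [Function.comp_apply, sTr_apply_ne (show l ≠ i by omega) (by omega)])
    have h1 : (r ∘ sTr i) (i + 1) = r i := by simp [sTr]
    have h2 : (r ∘ sTr i) i = r (i + 1) := by simp [sTr]
    simp only [colOp, e, h1, h2]
    rw [mul_assoc (colOp _ _ _ _ _ _), ← mul_assoc (rowEx _ _ _ _), h.eq, mul_assoc, rowEx_tile]
    simp only [mul_assoc]
  | succ m hm ih =>
    have hm' : i + 1 < m := hm
    have e : (r ∘ sTr i) m = r m := by
      simp only [Function.comp_apply, sTr_apply_ne (show m ≠ i by omega) (by omega)]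
    have h : Commute (rowEx β (r i) (r (i + 1)) i)
        (tileOp (fun _ => true) β (oplus β (t j) (r m)) m j) :=
      lineOp_commute _ _ _ _ (by simp) (by simp; omega) (by simp) (by simp; omega)
    simp only [colOp, e]
    rw [← mul_assoc, ih, mul_assoc, h.eq, mul_assoc]

lemma rowEx_gridOp (β : R) (t r : ℕ → R) (c : ℕ) {i m : ℕ} (hi : i + 1 < m) :
    rowEx β (r i) (r (i + 1)) i * gridOp (fun _ => true) β t r m c =
      gridOp (fun _ => true) β t (r ∘ sTr i) m c * rowEx β (r i) (r (i + 1)) i := by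
  induction c with
  | zero => simp [gridOp]
  | succ c ih =>
    simp only [gridOp]
    rw [← mul_assoc, rowEx_colOp β t r c hi, mul_assoc, ih, mul_assoc]

end

/-! ### Boundary values and the recursions for partition functions -/

section
variable {R : Type*} [CommRing R]

open Classical in
/-- The indicator function of the labels on the left and bottom sides for the permutation `w`. -/
def target (R : Type*) [CommRing R] (w : Equiv.Perm ℕ) : Lines → R := fun f =>
  if f = Sum.elim (fun _ => 0) (etaLab w) then 1 else 0

lemma target_ne {w : Equiv.Perm ℕ} {f : Lines} (j : ℕ) (h : f (Sum.inr j) ≠ etaLab w j) :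
    target R w f = 0 := if_neg fun e => h (by rw [e]; rfl)

lemma sTr_mul_inv_apply (i : ℕ) (w : Equiv.Perm ℕ) (j : ℕ) : (sTr i * w)⁻¹ j = w⁻¹ (sTr i j) := by
  simp [sTr, mul_inv_rev]

lemma etaLab_sTr (i : ℕ) (w : Equiv.Perm ℕ) (j : ℕ) :
    etaLab (sTr i * w) j = etaLab w (sTr i j) := by
  simp only [etaLab, sTr_mul_inv_apply]

lemma thetaLab_sTr (k i : ℕ) (w : Equiv.Perm ℕ) (j : ℕ) :
    thetaLab k (sTr i * w) j = thetaLab k w (sTr i j) := by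
  simp only [thetaLab, sTr_mul_inv_apply]

lemma kappaLab_sTr (k i : ℕ) (w : Equiv.Perm ℕ) (j : ℕ) :
    kappaLab k (sTr i * w) j = kappaLab k w (sTr i j) := by
  simp only [kappaLab, sTr_mul_inv_apply]

lemma swap_inr (i j : ℕ) : Equiv.swap (Sum.inr i : ℕ ⊕ ℕ) (Sum.inr (i + 1)) (Sum.inr j) =
    Sum.inr (sTr i j) := by
  simp only [sTr, Equiv.swap_apply_def, Sum.inr.injEq]; split_ifs <;> rfl

lemma swap_inl (i j : ℕ) : Equiv.swap (Sum.inl i : ℕ ⊕ ℕ) (Sum.inl (i + 1)) (Sum.inl j) =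
    Sum.inl (sTr i j) := by
  simp only [sTr, Equiv.swap_apply_def, Sum.inl.injEq]; split_ifs <;> rfl

lemma elim_comp_swap_inr (a b : ℕ → ℕ) (i : ℕ) :
    Sum.elim a b ∘ Equiv.swap (Sum.inr i) (Sum.inr (i + 1)) = Sum.elim a (b ∘ sTr i) := by
  ext (z | z)
  · simp [Equiv.swap_apply_of_ne_of_ne]
  · simp only [Function.comp_apply, swap_inr, Sum.elim_inr]

lemma elim_comp_swap_inl (a b : ℕ → ℕ) (i : ℕ) :
    Sum.elim a b ∘ Equiv.swap (Sum.inl i) (Sum.inl (i + 1)) = Sum.elim (a ∘ sTr i) b := by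
  ext (z | z)
  · simp only [Function.comp_apply, swap_inl, Sum.elim_inl]
  · simp [Equiv.swap_apply_of_ne_of_ne]

lemma comp_swap_eq_iff {p q : ℕ ⊕ ℕ} {f g : Lines} :
    f ∘ Equiv.swap p q = g ↔ f = g ∘ Equiv.swap p q := by
  constructor
  · rintro rfl; ext z; simp
  · rintro rfl; ext z; simp

open Classical in
lemma target_comp_swap_inr (w : Equiv.Perm ℕ) (f : Lines) (j : ℕ) :
    target R w (f ∘ Equiv.swap (Sum.inr j) (Sum.inr (j + 1))) = target R (sTr j * w) f := by
  have e : etaLab (sTr j * w) = etaLab w ∘ sTr j := funext fun i => etaLab_sTr j w i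
  exact if_congr (by rw [comp_swap_eq_iff, elim_comp_swap_inr, e]) rfl rfl

open Classical in
lemma target_comp_swap_inl (w : Equiv.Perm ℕ) (f : Lines) (i : ℕ) :
    target R w (f ∘ Equiv.swap (Sum.inl i) (Sum.inl (i + 1))) = target R w f :=
  if_congr (by rw [comp_swap_eq_iff, elim_comp_swap_inl]; rfl) rfl rfl

lemma mul_target {w : Equiv.Perm ℕ} {f : Lines} {a b : R}
    (h : f = Sum.elim (fun _ => 0) (etaLab w) → a = b) : a * target R w f = b * target R w f := by
  by_cases e : f = Sum.elim (fun _ => 0) (etaLab w)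
  · rw [h e]
  · rw [target, if_neg e, mul_zero, mul_zero]

lemma colEx_target (kd : ℕ → Bool) (β t₁ t₂ : R) (j : ℕ) {w : Equiv.Perm ℕ}
    (hw : w⁻¹ j < w⁻¹ (j + 1)) :
    colEx kd β t₁ t₂ j (target R w) =
      (1 + β * t₁) • target R w + (t₂ - t₁) • target R (sTr j * w) := by
  have hw' : etaLab w j < etaLab w (j + 1) := by unfold etaLab; omega
  have h0 : etaLab w j ≠ 0 := Nat.succ_ne_zero _
  ext f
  simp only [colEx, lineOp_apply, Pi.add_apply, Pi.smul_apply, smul_eq_mul, target_comp_swap_inr]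
  congr 1
  · refine mul_target fun h => ?_
    rw [h]
    simp [colDiag, hw'.not_gt, h0]
  · refine mul_target fun h => ?_
    rw [h]
    simp only [colOff, Sum.elim_inr, etaLab_sTr]
    simp [sTr, hw']

lemma rowEx_target (β r₁ r₂ : R) (i : ℕ) (w : Equiv.Perm ℕ) :
    rowEx β r₁ r₂ i (target R w) = (1 + β * r₁) • target R w := by
  ext f
  simp only [rowEx, lineOp_apply, Pi.smul_apply, smul_eq_mul, target_comp_swap_inl, ← add_mul]
  refine mul_target fun h => ?_
  rw [h]
  simp [rowDiag, rowOff, rowGt]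

lemma gridOp_colEx_apply (kd : ℕ → Bool) (hkd : ∀ a b, a ≤ b → kd b = true → kd a = true) (β : R)
    (t r : ℕ → R) (m : ℕ) {j c : ℕ} (hj : j + 1 < c) {w : Equiv.Perm ℕ}
    (hw : w⁻¹ j < w⁻¹ (j + 1)) (a b : ℕ → ℕ) :
    colDiag kd β (t j) (t (j + 1)) (b j) (b (j + 1)) *
        gridOp kd β (t ∘ sTr j) r m c (target R w) (Sum.elim a b) +
      colOff (t j) (t (j + 1)) (b j) (b (j + 1)) *
        gridOp kd β (t ∘ sTr j) r m c (target R w) (Sum.elim a (b ∘ sTr j)) =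
    (1 + β * t j) * gridOp kd β t r m c (target R w) (Sum.elim a b) +
      (t (j + 1) - t j) * gridOp kd β t r m c (target R (sTr j * w)) (Sum.elim a b) := by
  have h := congrFun (LinearMap.congr_fun (colEx_gridOp kd hkd β t r m hj) (target R w))
    (Sum.elim a b)
  rw [Module.End.mul_apply, Module.End.mul_apply, colEx_target kd β _ _ j hw, map_add, map_smul,
    map_smul, colEx, lineOp_apply, elim_comp_swap_inr] at h
  exact h

lemma gridOp_rowEx_apply (β : R) (t r : ℕ → R) (c : ℕ) {i m : ℕ} (hi : i + 1 < m)
    (w : Equiv.Perm ℕ) (a b : ℕ → ℕ) :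
    rowDiag β (r i) (r (i + 1)) (a i) (a (i + 1)) *
        gridOp (fun _ => true) β t r m c (target R w) (Sum.elim a b) +
      rowOff (r i) (r (i + 1)) (a i) (a (i + 1)) *
        gridOp (fun _ => true) β t r m c (target R w) (Sum.elim (a ∘ sTr i) b) =
    (1 + β * r i) *
      gridOp (fun _ => true) β t (r ∘ sTr i) m c (target R w) (Sum.elim a b) := by
  have h := congrFun (LinearMap.congr_fun (rowEx_gridOp β t r c hi) (target R w))
    (Sum.elim a b)
  rw [Module.End.mul_apply, Module.End.mul_apply, rowEx_target, map_smul, rowEx, lineOp_apply,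
    elim_comp_swap_inl] at h
  exact h

/-- The partition function of the pipe puzzles for `(u, v, w)`. -/
def puzzleSum (β : R) (n k : ℕ) (t r : ℕ → R) (u v w : Equiv.Perm ℕ) : R :=
  gridOp (fun a => decide (a ≤ k)) β t r n n (target R w) (Sum.elim (kappaLab k u) (thetaLab k v))

lemma inv_lt_of_incr {k : ℕ} {v : Equiv.Perm ℕ} (hv : ∀ i, i + 1 < k → v i ≤ v (i + 1)) {i j : ℕ}
    (hij : i < j) (hj : j < k) : v i < v j := by
  induction j, hij using Nat.le_induction with
  | base => exact lt_of_le_of_ne (hv i hj) (fun h => by simpa using v.injective h)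
  | succ j hj' ih =>
    exact lt_trans (ih (by omega))
      (lt_of_le_of_ne (hv j hj) (fun h => by simpa using v.injective h))

lemma puzzleSum_of_gt (β : R) (n k : ℕ) (t r : ℕ → R) (u : Equiv.Perm ℕ) {v w : Equiv.Perm ℕ}
    (hv : ∀ i, i + 1 < k → v i ≤ v (i + 1)) {j : ℕ} (hj : j + 1 < n)
    (hw : w⁻¹ j < w⁻¹ (j + 1)) (hvj : v⁻¹ (j + 1) < v⁻¹ j) :
    (t j - t (j + 1)) * (puzzleSum β n k t r u v (sTr j * w) -
        puzzleSum β n k (t ∘ sTr j) r u (sTr j * v) w) =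
      (1 + β * t j) * puzzleSum β n k t r u v w -
        (1 + β * t (j + 1)) * puzzleSum β n k (t ∘ sTr j) r u v w := by
  have hkj : k ≤ v⁻¹ j := by
    by_contra h
    push Not at h
    have := inv_lt_of_incr hv hvj h
    simp at this
  have h := gridOp_colEx_apply (fun a => decide (a ≤ k))
    (fun a b h h' => by simp only [decide_eq_true_eq] at h' ⊢; omega) β t r n hj hw
    (kappaLab k u) (thetaLab k v)
  have e : thetaLab k v ∘ sTr j = thetaLab k (sTr j * v) :=
    funext fun i => (thetaLab_sTr k j v i).symm
  have e1 : thetaLab k v (j + 1) < thetaLab k v j := by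
    unfold thetaLab; split_ifs <;> omega
  have e2 : k < thetaLab k v j := by
    unfold thetaLab; split_ifs; omega
  rw [e] at h
  simp only [colDiag, colOff, e1, if_true, decide_eq_true_eq, e2.not_ge, and_false, if_false] at h
  unfold puzzleSum
  linear_combination h

lemma puzzleSum_of_lt (β : R) (n k : ℕ) (t r : ℕ → R) (u : Equiv.Perm ℕ) {v w : Equiv.Perm ℕ}
    {j : ℕ} (hj : j + 1 < n)
    (hw : w⁻¹ j < w⁻¹ (j + 1)) (hvj : v⁻¹ j < v⁻¹ (j + 1)) :
    (t j - t (j + 1)) * puzzleSum β n k t r u v (sTr j * w) =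
      (1 + β * t j) * (puzzleSum β n k t r u v w - puzzleSum β n k (t ∘ sTr j) r u v w) := by
  have h := gridOp_colEx_apply (fun a => decide (a ≤ k))
    (fun a b h h' => by simp only [decide_eq_true_eq] at h' ⊢; omega) β t r n hj hw
    (kappaLab k u) (thetaLab k v)
  have e1 : ¬ thetaLab k v (j + 1) < thetaLab k v j := by
    unfold thetaLab; split_ifs <;> omega
  have e2 : ¬ (thetaLab k v j = 0 ∧ thetaLab k v (j + 1) ≠ 0 ∧
      decide (thetaLab k v (j + 1) ≤ k) = true) := by
    simp only [decide_eq_true_eq]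
    unfold thetaLab; split_ifs <;> omega
  simp only [colDiag, colOff, e1, e2, if_false] at h
  unfold puzzleSum
  linear_combination h

/-! ### Single columns -/

/-- The tiles of column `j` in the `m` rows starting with row `a`. -/
def colFrom (kd : ℕ → Bool) (β : R) (t r : ℕ → R) (j : ℕ) : ℕ → ℕ → Module.End R (Lines → R)
  | _, 0 => 1
  | a, m + 1 => tileOp kd β (oplus β (t j) (r a)) a j * colFrom kd β t r j (a + 1) m

lemma colOp_add (kd : ℕ → Bool) (β : R) (t r : ℕ → R) (j a m : ℕ) :
    colOp kd β t r j (a + m) = colOp kd β t r j a * colFrom kd β t r j a m := by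
  induction m generalizing a with
  | zero => simp [colFrom]
  | succ m ih =>
    rw [show a + (m + 1) = (a + 1) + m by omega, ih, colFrom, colOp, mul_assoc]

lemma colOp_eq_colFrom (kd : ℕ → Bool) (β : R) (t r : ℕ → R) (j m : ℕ) :
    colOp kd β t r j m = colFrom kd β t r j 0 m := by
  have := colOp_add kd β t r j 0 m
  simpa [colOp] using this

lemma comp_swap_inr (f : Lines) (i j : ℕ) :
    (f ∘ Equiv.swap (Sum.inr j) (Sum.inl i)) (Sum.inr j) = f (Sum.inl i) := by simp

lemma comp_swap_inl (f : Lines) (i j : ℕ) :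
    (f ∘ Equiv.swap (Sum.inr j) (Sum.inl i)) (Sum.inl i) = f (Sum.inr j) := by simp

lemma comp_swap_inl_ne (f : Lines) {i i' : ℕ} (j : ℕ) (h : i' ≠ i) :
    (f ∘ Equiv.swap (Sum.inr j) (Sum.inl i)) (Sum.inl i') = f (Sum.inl i') := by
  rw [Function.comp_apply, Equiv.swap_apply_of_ne_of_ne (by simp) (by simpa using h)]

lemma comp_swap_inr_ne (f : Lines) (i : ℕ) {j j' : ℕ} (h : j' ≠ j) :
    (f ∘ Equiv.swap (Sum.inr j) (Sum.inl i)) (Sum.inr j') = f (Sum.inr j') := by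
  rw [Function.comp_apply, Equiv.swap_apply_of_ne_of_ne (by simpa using h) (by simp)]

lemma colFrom_succ_apply (kd : ℕ → Bool) (β : R) (t r : ℕ → R) (j a m : ℕ) (φ : Lines → R)
    (f : Lines) : colFrom kd β t r j a (m + 1) φ f =
      passWt (oplus β (t j) (r a)) (f (Sum.inr j)) (f (Sum.inl a)) *
        colFrom kd β t r j (a + 1) m φ f +
      turnWt kd β (oplus β (t j) (r a)) (f (Sum.inr j)) (f (Sum.inl a)) *
        colFrom kd β t r j (a + 1) m φ (f ∘ Equiv.swap (Sum.inr j) (Sum.inl a)) := rfl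

lemma colFrom_eq_zero (kd : ℕ → Bool) (β : R) (t r : ℕ → R) {j J : ℕ} {φ : Lines → R}
    (hφ : ∀ f : Lines, f (Sum.inr j) ≠ J → φ f = 0) {a m : ℕ} {f : Lines}
    (hf : f (Sum.inr j) ≠ J) (hrow : ∀ i, a ≤ i → i < a + m → f (Sum.inl i) ≠ J) :
    colFrom kd β t r j a m φ f = 0 := by
  induction m generalizing a f with
  | zero => exact hφ f hf
  | succ m ih =>
    rw [colFrom_succ_apply, ih hf fun i h h' => hrow i (by omega) (by omega), ih, mul_zero,
      mul_zero, add_zero]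
    · rw [comp_swap_inr]; exact hrow a le_rfl (by omega)
    · intro i h h'
      rw [comp_swap_inl_ne f j (by omega)]
      exact hrow i (by omega) (by omega)

lemma colFrom_straight (kd : ℕ → Bool) (β : R) (t r : ℕ → R) {j : ℕ} {φ : Lines → R} {a m : ℕ}
    {f : Lines} (hφ : ∀ g : Lines, g (Sum.inr j) ≠ f (Sum.inr j) → φ g = 0)
    (hrow : ∀ i, a ≤ i → i < a + m → f (Sum.inl i) < f (Sum.inr j)) :
    colFrom kd β t r j a m φ f = φ f := by
  induction m generalizing a with
  | zero => rfl
  | succ m ih =>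
    have h0 := hrow a le_rfl (by omega)
    rw [colFrom_succ_apply, ih fun i h h' => hrow i (by omega) (by omega),
      colFrom_eq_zero kd β t r hφ (by rw [comp_swap_inr]; exact h0.ne), mul_zero, add_zero]
    · rw [passWt, if_neg (by omega), if_pos (Or.inr h0), one_mul]
    · intro i h h'
      rw [comp_swap_inl_ne f j (by omega)]
      exact (hrow i (by omega) (by omega)).ne

lemma colFrom_stuck (β : R) (t r : ℕ → R) {j : ℕ} {φ : Lines → R} {a p m : ℕ} {f : Lines}
    (hpm : p < m) (h0 : 0 < f (Sum.inr j)) (hJ : f (Sum.inr j) < f (Sum.inl (a + p)))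
    (hrow : ∀ i, a ≤ i → i < a + p → 0 < f (Sum.inl i)) :
    colFrom (fun _ => true) β t r j a m φ f = 0 := by
  induction p generalizing a m f with
  | zero =>
    obtain ⟨m, rfl⟩ := Nat.exists_eq_succ_of_ne_zero hpm.ne'
    rw [Nat.add_zero] at hJ
    rw [colFrom_succ_apply, passWt, turnWt, if_neg (by omega), if_neg (by omega),
      if_neg (by omega), if_neg (by omega), if_neg (by simp)]
    simp
  | succ p ih =>
    obtain ⟨m, rfl⟩ := Nat.exists_eq_succ_of_ne_zero (show m ≠ 0 by omega)
    have ha := hrow a le_rfl (by omega)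
    rw [show a + (p + 1) = a + 1 + p by omega] at hJ
    by_cases hlt : f (Sum.inl a) < f (Sum.inr j)
    · rw [colFrom_succ_apply, ih (by omega) h0 hJ fun i h h' => hrow i (by omega) (by omega),
        ih (by omega) (by rwa [comp_swap_inr]), mul_zero, mul_zero, add_zero]
      · rw [comp_swap_inr, comp_swap_inl_ne f j (by omega)]; omega
      · intro i h h'
        rw [comp_swap_inl_ne f j (by omega)]
        exact hrow i (by omega) (by omega)
    · rw [colFrom_succ_apply, passWt, turnWt, if_neg (by omega), if_neg (by omega),
        if_neg (by omega), if_neg (by omega), if_neg (by simp)]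
      simp

lemma colFrom_hook (β : R) (t r : ℕ → R) {j : ℕ} {φ : Lines → R} {a p m : ℕ} {f : Lines}
    (hpm : p < m) (hφ : ∀ g : Lines, g (Sum.inr j) ≠ f (Sum.inl (a + p)) → φ g = 0)
    (h0 : f (Sum.inr j) = 0) (hrow : ∀ i, a ≤ i → i < a + p → 0 < f (Sum.inl i))
    (hJ : ∀ i, a ≤ i → i < a + m → i ≠ a + p → f (Sum.inl i) < f (Sum.inl (a + p)))
    (hpos : 0 < f (Sum.inl (a + p))) :
    colFrom (fun _ => true) β t r j a m φ f =
      φ (f ∘ Equiv.swap (Sum.inr j) (Sum.inl (a + p))) := by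
  induction p generalizing a m with
  | zero =>
    obtain ⟨m, rfl⟩ := Nat.exists_eq_succ_of_ne_zero hpm.ne'
    rw [Nat.add_zero] at *
    rw [colFrom_succ_apply, colFrom_eq_zero _ β t r hφ (by omega), colFrom_straight, mul_zero,
      zero_add, turnWt, h0]
    · simp [hpos.ne']
    · rwa [comp_swap_inr]
    · intro i h h'
      rw [comp_swap_inr, comp_swap_inl_ne f j (by omega)]
      exact hJ i (by omega) (by omega) (by omega)
    · intro i h h'
      exact (hJ i (by omega) (by omega) (by omega)).ne
  | succ p ih =>
    obtain ⟨m, rfl⟩ := Nat.exists_eq_succ_of_ne_zero (show m ≠ 0 by omega)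
    have ha := hrow a le_rfl (by omega)
    rw [show a + (p + 1) = a + 1 + p by omega] at *
    rw [colFrom_succ_apply, ih (by omega) hφ (fun i h h' => hrow i (by omega) (by omega))
      (fun i h h' h'' => hJ i (by omega) (by omega) h'') hpos, colFrom_stuck (p := p) β t r (by omega),
      mul_zero, add_zero, passWt, h0]
    · simp [ha.ne']
    · rwa [comp_swap_inr]
    · rw [comp_swap_inr, comp_swap_inl_ne f j (by omega)]
      exact hJ a le_rfl (by omega) (by omega)
    · intro i h h'
      rw [comp_swap_inl_ne f j (by omega)]
      exact hrow i (by omega) (by omega)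

lemma colFrom_empty (kd : ℕ → Bool) (β : R) (t r : ℕ → R) {j : ℕ} {φ : Lines → R} {a z m : ℕ}
    {f : Lines} (h0 : f (Sum.inr j) = 0) (hrow : ∀ i, a ≤ i → i < a + z → f (Sum.inl i) = 0) :
    colFrom kd β t r j a (z + m) φ f =
      (∏ i ∈ Finset.range z, oplus β (t j) (r (a + i))) *
        colFrom kd β t r j (a + z) m φ f := by
  induction z generalizing a with
  | zero => simp
  | succ z ih =>
    rw [show z + 1 + m = (z + m) + 1 by omega, colFrom_succ_apply,
      ih fun i h h' => hrow i (by omega) (by omega), h0, hrow a le_rfl (by omega)]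
    rw [Finset.prod_range_succ', show a + (z + 1) = a + 1 + z by omega]
    simp only [passWt, turnWt, and_self, if_true, lt_irrefl, if_false, zero_mul, add_zero]
    rw [← mul_assoc, mul_comm (oplus β (t j) (r a))]
    congr 3
    ext i
    rw [show a + 1 + i = a + (i + 1) by omega]

lemma colOp_eq_zero_of_fixed (kd : ℕ → Bool) (β : R) (t r : ℕ → R) {j j' J : ℕ} {φ : Lines → R}
    (hj : j' ≠ j) (hφ : ∀ f : Lines, f (Sum.inr j) ≠ J → φ f = 0) (m : ℕ) {f : Lines}
    (hf : f (Sum.inr j) ≠ J) : colOp kd β t r j' m φ f = 0 := by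
  induction m generalizing φ with
  | zero => exact hφ f hf
  | succ m ih =>
    rw [colOp, Module.End.mul_apply]
    apply ih
    intro g hg
    rw [tileOp, lineOp_apply, hφ g hg, hφ, mul_zero, mul_zero, add_zero]
    rwa [comp_swap_inr_ne g m hj.symm]

lemma gridOp_eq_zero_of_fixed (kd : ℕ → Bool) (β : R) (t r : ℕ → R) {j J c : ℕ} {φ : Lines → R}
    (hj : c ≤ j) (hφ : ∀ f : Lines, f (Sum.inr j) ≠ J → φ f = 0) (m : ℕ) {f : Lines}
    (hf : f (Sum.inr j) ≠ J) : gridOp kd β t r m c φ f = 0 := by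
  induction c generalizing f with
  | zero => exact hφ f hf
  | succ c ih =>
    rw [gridOp, Module.End.mul_apply]
    exact colOp_eq_zero_of_fixed kd β t r (by omega) (fun g hg => ih (by omega) hg) m hf

lemma gridOp_target_eq_zero (kd : ℕ → Bool) (β : R) (t r : ℕ → R) {j c : ℕ} (hj : c ≤ j) (m : ℕ)
    (w : Equiv.Perm ℕ) (f : Lines) (hf : f (Sum.inr j) ≠ etaLab w j) :
    gridOp kd β t r m c (target R w) f = 0 :=
  gridOp_eq_zero_of_fixed kd β t r hj (fun _ h => target_ne j h) m hf

/-- The labels after the columns `j ≥ c` have been traversed. -/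
def midLines (c : ℕ) (u : Equiv.Perm ℕ) : Lines :=
  Sum.elim (kappaLab c u) (fun j => if j < c then 0 else j + 1)

lemma etaLab_one (j : ℕ) : etaLab 1 j = j + 1 := rfl

lemma midLines_swap (j : ℕ) (u : Equiv.Perm ℕ) :
    midLines (j + 1) u ∘ Equiv.swap (Sum.inr j) (Sum.inl (u j)) = midLines j u := by
  ext (i | i)
  · by_cases h : i = u j
    · subst h; rw [comp_swap_inl]; simp [midLines, kappaLab]
    · rw [comp_swap_inl_ne _ _ h]
      have : u⁻¹ i ≠ j := fun e => h (by rw [← e]; simp)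
      simp only [midLines, kappaLab, Sum.elim_inl]
      split_ifs <;> omega
  · by_cases h : i = j
    · subst h; rw [comp_swap_inr]; simp [midLines, kappaLab]
    · rw [comp_swap_inr_ne _ _ h]
      simp only [midLines, Sum.elim_inr]
      split_ifs <;> omega

lemma gridOp_succ_midLines (β : R) (t r : ℕ → R) {j z n : ℕ} {u : Equiv.Perm ℕ} (hun : u j < n)
    (hzu : z ≤ u j) (hz : ∀ i < z, j < u⁻¹ i) (hz' : ∀ i, z ≤ i → i < u j → u⁻¹ i < j) :
    gridOp (fun _ => true) β t r n (j + 1) (target R 1) (midLines (j + 1) u) =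
      (∏ i ∈ Finset.range z, oplus β (t j) (r i)) *
        gridOp (fun _ => true) β t r n j (target R 1) (midLines j u) := by
  have hJ : midLines (j + 1) u (Sum.inl (u j)) = j + 1 := by simp [midLines, kappaLab]
  have hlt : ∀ i, i ≠ u j → midLines (j + 1) u (Sum.inl i) < j + 1 := by
    intro i hi
    have : u⁻¹ i ≠ j := fun e => hi (by rw [← e]; simp)
    simp only [midLines, kappaLab, Sum.elim_inl]
    split_ifs <;> omega
  have e : z + (u j - z) = u j := by omega
  rw [gridOp, Module.End.mul_apply, colOp_eq_colFrom, ← midLines_swap j u]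
  conv_lhs => rw [show n = z + (n - z) by omega]
  rw [colFrom_empty]
  · have := colFrom_hook β t r (j := j) (a := z) (p := u j - z) (m := n - z)
      (f := midLines (j + 1) u) (φ := gridOp (fun _ => true) β t r n j (target R 1)) (by omega)
      (by
        intro g hg
        rw [e, hJ] at hg
        exact gridOp_target_eq_zero _ β t r le_rfl n 1 g hg)
      (by simp [midLines])
      (by
        intro i h h'
        have := hz' i h (by omega)
        simp only [midLines, kappaLab, Sum.elim_inl]
        split_ifs <;> omega)
      (by
        intro i h h' h''
        rw [e] at h'' ⊢
        rw [hJ]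
        exact hlt i h'')
      (by rw [e, hJ]; omega)
    rw [e] at this
    rw [show z + (n - z) = n by omega, Nat.zero_add, this]
    simp
  · simp [midLines]
  · intro i h h'
    have := hz i (by omega)
    simp only [midLines, kappaLab, Sum.elim_inl]
    split_ifs <;> omega

end

/-! ### Permutations of an initial segment -/

lemma InSn.lt {n : ℕ} {w : Equiv.Perm ℕ} (hw : InSn n w) {j : ℕ} (hj : j < n) : w j < n := by
  by_contra h
  have := w.injective (hw (w j) (by omega))
  omega

lemma InSn.inv {n : ℕ} {w : Equiv.Perm ℕ} (hw : InSn n w) : InSn n w⁻¹ := fun j hj => by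
  rw [Equiv.Perm.inv_eq_iff_eq, hw j hj]

lemma InSn.mul {n : ℕ} {w w' : Equiv.Perm ℕ} (hw : InSn n w) (hw' : InSn n w') :
    InSn n (w * w') := fun j hj => by
  rw [Equiv.Perm.mul_apply, hw' j hj, hw j hj]

lemma InSn.sTr {n i : ℕ} (h : i + 1 < n) : InSn n (sTr i) := fun _ hj =>
  sTr_apply_ne (by omega) (by omega)

lemma InSn.one (n : ℕ) : InSn n 1 := fun _ _ => rfl

lemma InSn.revPerm (n : ℕ) : InSn n (revPerm n) := fun j hj => if_neg (by omega)

lemma revPerm_apply {n j : ℕ} (hj : j < n) : revPerm n j = n - 1 - j := if_pos hj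

lemma revPerm_inv (n : ℕ) : (revPerm n)⁻¹ = revPerm n := rfl

lemma sTr_mul_self (i : ℕ) : sTr i * sTr i = 1 := Equiv.swap_mul_self _ _

lemma sTr_inv (i : ℕ) : (sTr i)⁻¹ = sTr i := Equiv.swap_inv _ _

lemma sTr_left (i : ℕ) : sTr i i = i + 1 := Equiv.swap_apply_left _ _

lemma sTr_right (i : ℕ) : sTr i (i + 1) = i := Equiv.swap_apply_right _ _

lemma eq_one_of_no_descent {w : Equiv.Perm ℕ} (h : ∀ i, w i ≤ w (i + 1)) : w = 1 := by
  have hm : StrictMono w := strictMono_nat_of_lt_succ fun i =>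
    lt_of_le_of_ne (h i) fun e => by simpa using w.injective e
  have hm' : StrictMono ⇑w⁻¹ := fun a b hab => by
    by_contra h'
    have := hm.monotone (not_lt.mp h')
    rw [show w (w⁻¹ a) = a by simp, show w (w⁻¹ b) = b by simp] at this
    omega
  ext i
  have h1 := hm.le_apply (x := i)
  have h2 := hm'.le_apply (x := w i)
  rw [show w⁻¹ (w i) = i by simp] at h2
  exact le_antisymm h2 h1

/-! ### Grothendieck polynomials as partition functions -/

section
variable {R : Type*} [CommRing R]

lemma map_tileOp {S : Type*} [CommRing S] (ρ : R →+* S) (kd : ℕ → Bool) (β x : R) (i j : ℕ)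
    (φ : Lines → R) (f : Lines) :
    ρ (tileOp kd β x i j φ f) = tileOp kd (ρ β) (ρ x) i j (ρ ∘ φ) f := by
  have h1 : ∀ N E, ρ (passWt x N E) = passWt (ρ x) N E := by
    intro N E; unfold passWt; split_ifs <;> simp
  have h2 : ∀ N E, ρ (turnWt kd β x N E) = turnWt kd (ρ β) (ρ x) N E := by
    intro N E; unfold turnWt; split_ifs <;> simp
  simp only [tileOp, lineOp_apply, map_add, map_mul, h1, h2, Function.comp_apply]

lemma map_oplus {S : Type*} [CommRing S] (ρ : R →+* S) (β x y : R) :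
    ρ (oplus β x y) = oplus (ρ β) (ρ x) (ρ y) := by simp [oplus]

lemma map_colOp {S : Type*} [CommRing S] (ρ : R →+* S) (kd : ℕ → Bool) (β : R) (t r : ℕ → R)
    (j m : ℕ) (φ : Lines → R) (f : Lines) :
    ρ (colOp kd β t r j m φ f) = colOp kd (ρ β) (ρ ∘ t) (ρ ∘ r) j m (ρ ∘ φ) f := by
  induction m generalizing φ with
  | zero => rfl
  | succ m ih =>
    simp only [colOp, Module.End.mul_apply, ih]
    refine congrArg (fun ψ => colOp kd (ρ β) (ρ ∘ t) (ρ ∘ r) j m ψ f) (funext fun g => ?_)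
    simp only [Function.comp_apply, map_tileOp, map_oplus]

lemma map_gridOp {S : Type*} [CommRing S] (ρ : R →+* S) (kd : ℕ → Bool) (β : R) (t r : ℕ → R)
    (m c : ℕ) (φ : Lines → R) (f : Lines) :
    ρ (gridOp kd β t r m c φ f) = gridOp kd (ρ β) (ρ ∘ t) (ρ ∘ r) m c (ρ ∘ φ) f := by
  induction c generalizing f with
  | zero => rfl
  | succ c ih =>
    simp only [gridOp, Module.End.mul_apply, map_colOp]
    refine congrArg (fun ψ => colOp kd (ρ β) (ρ ∘ t) (ρ ∘ r) c m ψ f) (funext fun g => ?_)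
    simp only [Function.comp_apply, ih]

lemma comp_target {S : Type*} [CommRing S] (ρ : R →+* S) (w : Equiv.Perm ℕ) :
    ρ ∘ target R w = target S w := by
  ext f; simp only [Function.comp_apply, target]; split_ifs <;> simp

lemma map_puzzleSum {S : Type*} [CommRing S] (ρ : R →+* S) (β : R) (n k : ℕ) (t r : ℕ → R)
    (u v w : Equiv.Perm ℕ) :
    ρ (puzzleSum β n k t r u v w) = puzzleSum (ρ β) n k (ρ ∘ t) (ρ ∘ r) u v w := by
  simp only [puzzleSum, map_gridOp, comp_target]

/-- The double Grothendieck polynomial of `u ∈ S_n`, where `r i` stands for `⊖ y_i`. -/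
def groth (β : R) (n : ℕ) (r : ℕ → R) (u : Equiv.Perm ℕ) : MvPolynomial ℕ R :=
  gridOp (fun _ => true) (C β) X (C ∘ r) n n (target _ 1) (midLines n u)

lemma eval_groth (β : R) (n : ℕ) (t r : ℕ → R) (u : Equiv.Perm ℕ) :
    eval t (groth β n r u) =
      gridOp (fun _ => true) β t r n n (target R 1) (midLines n u) := by
  rw [groth, map_gridOp, comp_target, eval_C]
  have h1 : eval t ∘ X = t := by ext1; simp
  have h2 : eval t ∘ C ∘ r = r := by ext1; simp
  rw [h1, h2]

lemma map_groth {S : Type*} [CommRing S] (ρ : R →+* S) (β : R) (n : ℕ) (r : ℕ → R)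
    (u : Equiv.Perm ℕ) : map ρ (groth β n r u) = groth (ρ β) n (ρ ∘ r) u := by
  rw [groth, map_gridOp, comp_target, map_C, groth]
  have h1 : map ρ ∘ X = (X : ℕ → MvPolynomial ℕ S) := by ext1; simp
  have h2 : map ρ ∘ C ∘ r = (C ∘ ρ ∘ r : ℕ → MvPolynomial ℕ S) := by ext1; simp
  rw [h1, h2]

lemma midLines_comp_sTr (n i : ℕ) (u : Equiv.Perm ℕ) :
    Sum.elim (kappaLab n u ∘ sTr i) (fun j => if j < n then 0 else j + 1) =
      midLines n (sTr i * u) := by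
  have e : kappaLab n u ∘ sTr i = kappaLab n (sTr i * u) :=
    funext fun j => (kappaLab_sTr n i u j).symm
  rw [e]; rfl

/-- Left Demazure recursion at a descent. -/
lemma groth_left_of_gt (β : R) (n : ℕ) (r : ℕ → R) {u : Equiv.Perm ℕ} (hu : InSn n u) {i : ℕ}
    (hi : i + 1 < n) (h : u⁻¹ (i + 1) < u⁻¹ i) :
    C (r i - r (i + 1)) * groth β n r (sTr i * u) =
      C (1 + β * r (i + 1)) * groth β n r u - C (1 + β * r i) * groth β n (r ∘ sTr i) u := by
  have key := gridOp_rowEx_apply (C β) X (C ∘ r) n hi 1 (kappaLab n u)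
    (fun j => if j < n then 0 else j + 1)
  rw [midLines_comp_sTr] at key
  have h1 := hu.inv.lt hi
  have h2 := hu.inv.lt (show i < n by omega)
  have e1 : kappaLab n u (i + 1) = u⁻¹ (i + 1) + 1 := if_pos h1
  have e2 : kappaLab n u i = u⁻¹ i + 1 := if_pos h2
  have e3 : rowGt (kappaLab n u i) (kappaLab n u (i + 1)) := by
    rw [e1, e2]; exact ⟨by omega, by omega⟩
  simp only [rowDiag, rowOff, e3, if_true] at key
  simp only [map_sub, map_add, map_mul, map_one]
  unfold groth
  simp only [Function.comp_apply] at key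
  rw [show Sum.elim (kappaLab n u) (fun j => if j < n then 0 else j + 1) = midLines n u from rfl]
    at key
  rw [← Function.comp_assoc]
  linear_combination -key

/-- Left Demazure recursion at an ascent. -/
lemma groth_left_of_lt (β : R) (n : ℕ) (r : ℕ → R) {u : Equiv.Perm ℕ} (hu : InSn n u) {i : ℕ}
    (hi : i + 1 < n) (h : u⁻¹ i < u⁻¹ (i + 1)) (hr : IsUnit (1 + β * r i)) :
    groth β n (r ∘ sTr i) u = groth β n r u := by
  have key := gridOp_rowEx_apply (C β) X (C ∘ r) n hi 1 (kappaLab n u)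
    (fun j => if j < n then 0 else j + 1)
  have h1 := hu.inv.lt hi
  have h2 := hu.inv.lt (show i < n by omega)
  have e1 : kappaLab n u (i + 1) = u⁻¹ (i + 1) + 1 := if_pos h1
  have e2 : kappaLab n u i = u⁻¹ i + 1 := if_pos h2
  have e3 : ¬ rowGt (kappaLab n u i) (kappaLab n u (i + 1)) := by
    rw [e1, e2]; rintro ⟨-, h | h⟩ <;> omega
  simp only [rowDiag, rowOff, e3, if_false, zero_mul, add_zero, Function.comp_apply] at key
  have hU : IsUnit (1 + C β * C (r i) : MvPolynomial ℕ R) := by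
    simpa using hr.map (C : R →+* MvPolynomial ℕ R)
  exact (hU.mul_left_cancel key).symm

lemma lt_of_incr_from {k : ℕ} {u : Equiv.Perm ℕ} (hu : ∀ i, k ≤ i → u i ≤ u (i + 1)) {a b : ℕ}
    (ha : k ≤ a) (hab : a < b) : u a < u b := by
  induction b, hab using Nat.le_induction with
  | base => exact lt_of_le_of_ne (hu a ha) (fun h => by simpa using u.injective h)
  | succ b hb ih =>
    exact lt_trans ih (lt_of_le_of_ne (hu b (by have : a + 1 ≤ b := hb; omega))
      (fun h => by simpa using u.injective h))

lemma gridOp_midLines_of_incr (β : R) (t r : ℕ → R) {n k c : ℕ} {u : Equiv.Perm ℕ}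
    (hun : InSn n u) (hu : ∀ i, k ≤ i → u i ≤ u (i + 1)) (hkc : k ≤ c) (hcn : c ≤ n) :
    gridOp (fun _ => true) β t r n c (target R 1) (midLines c u) =
      gridOp (fun _ => true) β t r n k (target R 1) (midLines k u) := by
  induction c, hkc using Nat.le_induction with
  | base => rfl
  | succ c hc ih =>
    rw [gridOp_succ_midLines β t r (z := 0) (hun.lt hcn) (Nat.zero_le _) (by simp), ih (by omega)]
    · simp
    · intro i _ hi
      by_contra h
      rcases Nat.lt_or_ge c (u⁻¹ i) with h' | h'
      · have := lt_of_incr_from hu hc h'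
        simp at this
        omega
      · have : u⁻¹ i = c := by omega
        rw [← this] at hi
        simp at hi

lemma groth_one (β : R) (n : ℕ) (r : ℕ → R) : groth β n r 1 = 1 := by
  rw [groth, gridOp_midLines_of_incr (k := 0) _ _ _ (InSn.one n) (by simp) (Nat.zero_le _) le_rfl]
  have : midLines 0 1 = Sum.elim (fun _ => 0) (etaLab 1) := by
    ext (i | i) <;> simp [midLines, kappaLab, etaLab]
  exact if_pos this

lemma gridOp_midLines_revPerm (β : R) (t r : ℕ → R) {n c : ℕ} (hcn : c ≤ n) :
    gridOp (fun _ => true) β t r n c (target R 1) (midLines c (revPerm n)) =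
      ∏ j ∈ Finset.range c, ∏ i ∈ Finset.range (n - 1 - j), oplus β (t j) (r i) := by
  induction c with
  | zero =>
    have : midLines 0 (revPerm n) = Sum.elim (fun _ => 0) (etaLab 1) := by
      ext (i | i) <;> simp [midLines, kappaLab, etaLab]
    exact if_pos this
  | succ c ih =>
    have hc : revPerm n c = n - 1 - c := revPerm_apply (by omega)
    rw [gridOp_succ_midLines β t r (z := n - 1 - c) (by omega) hc.ge, ih (by omega),
      Finset.prod_range_succ, mul_comm]
    · intro i hi
      rw [revPerm_inv, revPerm_apply (by omega)]
      omega
    · intro i hi hi'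
      omega

lemma groth_revPerm (β : R) (n : ℕ) (r : ℕ → R) :
    groth β n r (revPerm n) =
      ∏ j ∈ Finset.range n, ∏ i ∈ Finset.range (n - 1 - j), oplus (C β) (X j) (C (r i)) :=
  gridOp_midLines_revPerm (C β) X (C ∘ r) le_rfl

/-! ### Partition functions with trivial bottom boundary -/

lemma gridOp_straight (kd : ℕ → Bool) (β : R) (t r : ℕ → R) {n k c : ℕ} (hkc : k ≤ c) {f : Lines}
    (hrow : ∀ i, f (Sum.inl i) ≤ k) (hcol : ∀ j, k ≤ j → j < c → f (Sum.inr j) = j + 1) :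
    gridOp kd β t r n c (target R 1) f = gridOp kd β t r n k (target R 1) f := by
  induction c, hkc using Nat.le_induction with
  | base => rfl
  | succ c hc ih =>
    rw [gridOp, Module.End.mul_apply, colOp_eq_colFrom, colFrom_straight,
      ih fun j h h' => hcol j h (by omega)]
    · intro g hg
      rw [hcol c hc (by omega)] at hg
      exact gridOp_target_eq_zero kd β t r le_rfl n 1 g hg
    · intro i _ _
      rw [hcol c hc (by omega)]
      exact Nat.lt_succ_of_le ((hrow i).trans hc)

lemma gridOp_eq_zero_of_label (kd : ℕ → Bool) (β : R) (t r : ℕ → R) {n k c j : ℕ} (hkj : k ≤ j)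
    (hjc : j < c) {f : Lines} (hrow : ∀ i, f (Sum.inl i) ≤ k) (hf : f (Sum.inr j) ≠ j + 1) :
    gridOp kd β t r n c (target R 1) f = 0 := by
  induction c, hjc using Nat.le_induction with
  | base =>
    rw [gridOp, Module.End.mul_apply, colOp_eq_colFrom]
    exact colFrom_eq_zero kd β t r
      (fun g hg => gridOp_target_eq_zero kd β t r le_rfl n 1 g hg) hf
      (fun i _ _ => by have := hrow i; rw [etaLab_one]; omega)
  | succ c hc ih =>
    have hc' : j < c := hc
    rw [gridOp, Module.End.mul_apply, colOp_eq_colFrom]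
    by_cases hcf : f (Sum.inr c) = c + 1
    · rw [colFrom_straight, ih]
      · intro g hg
        rw [hcf] at hg
        exact gridOp_target_eq_zero kd β t r le_rfl n 1 g hg
      · intro i _ _
        have := hrow i
        omega
    · exact colFrom_eq_zero kd β t r
        (fun g hg => gridOp_target_eq_zero kd β t r le_rfl n 1 g hg) hcf
        (fun i _ _ => by have := hrow i; rw [etaLab_one]; omega)

lemma colOp_kd_congr {kd kd' : ℕ → Bool} (β : R) (t r : ℕ → R) {j : ℕ} (m : ℕ)
    {φ φ' : Lines → R} {P : Lines → Prop}
    (hP : ∀ f i, P f → P (f ∘ Equiv.swap (Sum.inr j) (Sum.inl i)))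
    (hkd : ∀ f i, P f → kd (f (Sum.inl i)) = kd' (f (Sum.inl i)) ∧
      kd (f (Sum.inr j)) = kd' (f (Sum.inr j)))
    (hφ : ∀ f, P f → φ f = φ' f) {f : Lines} (hf : P f) :
    colOp kd β t r j m φ f = colOp kd' β t r j m φ' f := by
  induction m generalizing φ φ' with
  | zero => exact hφ f hf
  | succ m ih =>
    rw [colOp, colOp, Module.End.mul_apply, Module.End.mul_apply]
    refine ih fun g hg => ?_
    obtain ⟨h1, h2⟩ := hkd g m hg
    rw [tileOp, tileOp, lineOp_apply, lineOp_apply, hφ g hg, hφ _ (hP g m hg)]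
    simp only [turnWt, h1, h2]

lemma gridOp_kd_congr {kd kd' : ℕ → Bool} (β : R) (t r : ℕ → R) (k m : ℕ) (φ : Lines → R)
    {f : Lines} (hf : (∀ i, kd (f (Sum.inl i)) = kd' (f (Sum.inl i))) ∧
      ∀ j < k, kd (f (Sum.inr j)) = kd' (f (Sum.inr j))) :
    gridOp kd β t r m k φ f = gridOp kd' β t r m k φ f := by
  suffices H : ∀ c ≤ k, ∀ f : Lines, ((∀ i, kd (f (Sum.inl i)) = kd' (f (Sum.inl i))) ∧
      ∀ j < k, kd (f (Sum.inr j)) = kd' (f (Sum.inr j))) →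
      gridOp kd β t r m c φ f = gridOp kd' β t r m c φ f from H k le_rfl f hf
  intro c hc
  induction c with
  | zero => exact fun _ _ => rfl
  | succ c ih =>
    intro f hf
    refine colOp_kd_congr β t r (j := c) m
      (P := fun f => (∀ i, kd (f (Sum.inl i)) = kd' (f (Sum.inl i))) ∧
        ∀ j < k, kd (f (Sum.inr j)) = kd' (f (Sum.inr j))) ?_ ?_ (ih (by omega)) hf
    · intro g i hg
      constructor
      · intro i'
        by_cases h : i' = i
        · subst h; rw [comp_swap_inl]; exact hg.2 c (by omega)
        · rw [comp_swap_inl_ne _ _ h]; exact hg.1 i'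
      · intro j hj
        by_cases h : j = c
        · subst h; rw [comp_swap_inr]; exact hg.1 i
        · rw [comp_swap_inr_ne _ _ h]; exact hg.2 j hj
    · intro g i hg
      exact ⟨hg.1 i, hg.2 c (by omega)⟩

lemma kappaLab_le (k : ℕ) (u : Equiv.Perm ℕ) (i : ℕ) : kappaLab k u i ≤ k := by
  unfold kappaLab; split_ifs <;> omega

lemma puzzleSum_one_one (β : R) {n k : ℕ} (hk : k ≤ n) (t r : ℕ → R) {u : Equiv.Perm ℕ}
    (hun : InSn n u) (hu : ∀ i, k ≤ i → u i ≤ u (i + 1)) :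
    puzzleSum β n k t r u 1 1 = eval t (groth β n r u) := by
  have e : Sum.elim (kappaLab k u) (thetaLab k 1) = midLines k u := by
    ext (i | i)
    · rfl
    · simp only [midLines, thetaLab, Sum.elim_inr, inv_one, Equiv.Perm.one_apply]
      split_ifs <;> omega
  rw [eval_groth, gridOp_midLines_of_incr β t r hun hu hk le_rfl, puzzleSum, e,
    gridOp_straight _ β t r hk (kappaLab_le k u)]
  · apply gridOp_kd_congr
    constructor
    · intro i; simp [midLines, kappaLab_le]
    · intro j hj; simp [midLines, hj]
  · intro j hj _
    simp [midLines, hj.not_gt]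

lemma puzzleSum_one_of_ne (β : R) {n k : ℕ} (t r : ℕ → R) (u : Equiv.Perm ℕ)
    {v : Equiv.Perm ℕ} (hvn : InSn n v) (hv : ∀ i, i + 1 < k → v i ≤ v (i + 1)) (h1 : v ≠ 1) :
    puzzleSum β n k t r u v 1 = 0 := by
  have : ∃ j, k ≤ j ∧ v⁻¹ j ≠ j := by
    by_contra hcon
    push Not at hcon
    have hfix : InSn k v := by
      intro j hj
      have := hcon j hj
      rw [Equiv.Perm.inv_eq_iff_eq] at this
      exact this.symm
    refine h1 (eq_one_of_no_descent fun i => ?_)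
    rcases Nat.lt_or_ge (i + 1) k with h | h
    · exact hv i h
    · rw [hfix (i + 1) h]
      rcases Nat.lt_or_ge i k with h' | h'
      · exact (hfix.lt h').le.trans h
      · rw [hfix i h']; omega
  obtain ⟨j, hkj, hj⟩ := this
  have hjn : j < n := by
    by_contra h
    exact hj (hvn.inv j (by omega))
  refine gridOp_eq_zero_of_label _ β t r hkj hjn (kappaLab_le k u) ?_
  simp only [thetaLab, Sum.elim_inr]
  split_ifs <;> omega

end

/-! ### Inversions -/

/-- The set of inversions of `w` in `{0, …, n-1}`. -/
def inversions (n : ℕ) (w : Equiv.Perm ℕ) : Finset (ℕ × ℕ) :=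
  (Finset.range n ×ˢ Finset.range n).filter fun p => p.1 < p.2 ∧ w p.2 < w p.1

lemma mem_inversions {n : ℕ} {w : Equiv.Perm ℕ} {a b : ℕ} :
    (a, b) ∈ inversions n w ↔ b < n ∧ a < b ∧ w b < w a := by
  simp only [inversions, Finset.mem_filter, Finset.mem_product, Finset.mem_range]
  omega

lemma sTr_apply (i j : ℕ) :
    sTr i j = if j = i then i + 1 else if j = i + 1 then i else j := Equiv.swap_apply_def _ _ _

lemma sTr_lt_sTr {i a b : ℕ} (h : a < b) (h' : ¬ (a = i ∧ b = i + 1)) : sTr i a < sTr i b := by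
  simp only [sTr_apply]; split_ifs <;> omega

lemma sTr_sTr (i a : ℕ) : sTr i (sTr i a) = a := Equiv.swap_apply_self _ _ _

lemma sTr_lt_iff {n i : ℕ} (h : i + 1 < n) (a : ℕ) : sTr i a < n ↔ a < n := by
  simp only [sTr_apply]; split_ifs <;> omega

lemma card_inversions_mul_sTr {n i : ℕ} {w : Equiv.Perm ℕ} (hi : i + 1 < n)
    (h : w i < w (i + 1)) :
    (inversions n (w * sTr i)).card = (inversions n w).card + 1 := by
  have e : inversions n (w * sTr i) = insert (i, i + 1)
      ((inversions n w).map (Equiv.prodCongr (sTr i) (sTr i)).toEmbedding) := by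
    ext ⟨a, b⟩
    simp only [Finset.mem_insert, Finset.mem_map_equiv, mem_inversions, Prod.mk.injEq,
      Equiv.Perm.mul_apply, Equiv.prodCongr_symm, Equiv.prodCongr_apply, Prod.map_apply,
      show (sTr i).symm = sTr i from sTr_inv i, sTr_lt_iff hi]
    by_cases hab : a = i ∧ b = i + 1
    · obtain ⟨rfl, rfl⟩ := hab
      simp [sTr_left, sTr_right, h, hi]
    · simp only [hab, false_or]
      refine and_congr_right fun _ => ⟨fun h' => ⟨sTr_lt_sTr h'.1 hab, h'.2⟩, fun h' => ⟨?_, h'.2⟩⟩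
      have := sTr_lt_sTr (i := i) h'.1 (by
        rintro ⟨h1, h2⟩
        have h1' : a = i + 1 := by rw [← sTr_sTr i a, h1, sTr_left]
        have h2' : b = i := by rw [← sTr_sTr i b, h2, sTr_right]
        subst h1' h2'
        have := h'.2
        rw [sTr_left, sTr_right] at this
        omega)
      rwa [sTr_sTr, sTr_sTr] at this
  rw [e, Finset.card_insert_of_notMem, Finset.card_map]
  simp only [Finset.mem_map_equiv, mem_inversions, Equiv.prodCongr_symm, Equiv.prodCongr_apply,
    Prod.map_apply, show (sTr i).symm = sTr i from sTr_inv i, sTr_left, sTr_right]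
  omega

lemma card_inversions_mul_sTr_le {n i : ℕ} (w : Equiv.Perm ℕ) (hi : i + 1 < n) :
    (inversions n (w * sTr i)).card ≤ (inversions n w).card + 1 := by
  rcases lt_or_gt_of_ne (fun h => by simpa using w.injective h : w i ≠ w (i + 1)) with h | h
  · exact (card_inversions_mul_sTr hi h).le
  · have := card_inversions_mul_sTr (w := w * sTr i) hi
      (by simpa [Equiv.Perm.mul_apply, sTr_left, sTr_right] using h)
    rw [mul_assoc, sTr_mul_self, mul_one] at this
    omega

lemma card_inversions_le (n : ℕ) (w : Equiv.Perm ℕ) : (inversions n w).card ≤ n * n := by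
  refine (Finset.card_filter_le _ _).trans ?_
  simp

lemma inversions_one (n : ℕ) : inversions n 1 = ∅ := by
  ext ⟨a, b⟩
  simp only [mem_inversions, Equiv.Perm.one_apply, Finset.notMem_empty, iff_false]
  omega

lemma card_inversions_pos {n : ℕ} {w : Equiv.Perm ℕ} (hw : InSn n w) (h1 : w ≠ 1) :
    0 < (inversions n w).card := by
  rw [Finset.card_pos]
  by_contra hemp
  refine h1 (eq_one_of_no_descent fun i => ?_)
  by_contra h
  push Not at h
  refine hemp ⟨(i, i + 1), mem_inversions.mpr ⟨?_, by omega, h⟩⟩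
  by_contra hn
  rw [hw (i + 1) (by omega)] at h
  rcases Nat.lt_or_ge i n with h' | h'
  · have := hw.lt h'
    omega
  · rw [hw i h'] at h
    omega

lemma eq_revPerm_of_le {n : ℕ} {w : Equiv.Perm ℕ} (hw : InSn n w)
    (h : ∀ i < n, n - 1 - i ≤ w i) : w = revPerm n := by
  have key : ∀ i < n, w (n - 1 - i) = i := by
    intro i
    induction i using Nat.strong_induction_on with
    | _ i ih =>
      intro hi
      have hge : ∀ m, m < n → w m = i → m = n - 1 - i := by
        intro m hm e
        have h1 := h m hm
        by_contra hne
        have h2 : n - 1 - m < i := by omega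
        have h3 := ih (n - 1 - m) h2 (by omega)
        rw [show n - 1 - (n - 1 - m) = m by omega] at h3
        omega
      have hm := hge (w⁻¹ i) (hw.inv.lt hi) (by simp)
      rw [← hm]
      simp
  ext j
  rcases Nat.lt_or_ge j n with hj | hj
  · rw [revPerm_apply hj, ← key (n - 1 - j) (by omega), show n - 1 - (n - 1 - j) = j by omega]
  · rw [hw j hj, InSn.revPerm n j hj]

lemma eq_revPerm_of_descents {n : ℕ} {w : Equiv.Perm ℕ} (hw : InSn n w)
    (h : ∀ i, i + 1 < n → w (i + 1) ≤ w i) : w = revPerm n := by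
  refine eq_revPerm_of_le hw ?_
  suffices H : ∀ d i, i + d + 1 = n → d ≤ w i by
    intro i hi
    exact H _ i (by omega)
  intro d
  induction d with
  | zero => simp
  | succ d ih =>
    intro i hi
    have h1 := ih (i + 1) (by omega)
    have h2 := h i (by omega)
    have h3 : w (i + 1) ≠ w i := fun e => by simpa using w.injective e
    omega

/-- Descending induction along the left weak order, starting from the longest element. -/
lemma left_weak_induction {n : ℕ} {P : Equiv.Perm ℕ → Prop} (base : P (revPerm n))
    (step : ∀ w i, InSn n w → i + 1 < n → w⁻¹ (i + 1) < w⁻¹ i → P w → P (sTr i * w))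
    {w : Equiv.Perm ℕ} (hw : InSn n w) : P w := by
  induction hm : n * n - (inversions n w⁻¹).card using Nat.strong_induction_on generalizing w with
  | _ m ih =>
    by_cases h0 : ∀ i, i + 1 < n → w⁻¹ (i + 1) ≤ w⁻¹ i
    · have := eq_revPerm_of_descents hw.inv h0
      rw [← inv_inv w, this, revPerm_inv]
      exact base
    · push Not at h0
      obtain ⟨i, hi, hlt⟩ := h0
      have hc := card_inversions_mul_sTr hi hlt
      have hle := card_inversions_le n (w⁻¹ * sTr i)
      have e : (sTr i * w)⁻¹ = w⁻¹ * sTr i := by rw [mul_inv_rev, sTr_inv]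
      have := ih _ (by rw [← hm, e]; omega) ((InSn.sTr hi).mul hw) rfl
      have h2 := step (sTr i * w) i ((InSn.sTr hi).mul hw) hi
        (by rw [e, Equiv.Perm.mul_apply, Equiv.Perm.mul_apply, sTr_left, sTr_right]; exact hlt) this
      rwa [← mul_assoc, sTr_mul_self, one_mul] at h2

lemma groth_revPerm_factor {R : Type*} [CommRing R] (β : R) {n i j : ℕ} (hij : i + j + 2 = n) (r : ℕ → R) :
    ∃ Q : MvPolynomial ℕ R,
      groth β n r (revPerm n) = Q * oplus (C β) (X j) (C (r i)) ∧
      groth β n (r ∘ sTr i) (revPerm n) = Q * oplus (C β) (X j) (C (r (i + 1))) ∧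
      rename (sTr j) (groth β n r (revPerm n)) = Q * oplus (C β) (X (j + 1)) (C (r i)) := by
  have hj : j ∈ Finset.range n := by simp; omega
  have hj' : j + 1 ∈ (Finset.range n).erase j := by simp; omega
  have e1 : n - 1 - j = i + 1 := by omega
  have e2 : n - 1 - (j + 1) = i := by omega
  refine ⟨(∏ i' ∈ Finset.range i, oplus (C β) (X j) (C (r i'))) *
    ((∏ i' ∈ Finset.range i, oplus (C β) (X (j + 1)) (C (r i'))) *
      ∏ j' ∈ ((Finset.range n).erase j).erase (j + 1),
        ∏ i' ∈ Finset.range (n - 1 - j'), oplus (C β) (X j') (C (r i'))), ?_, ?_, ?_⟩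
  · rw [groth_revPerm, ← Finset.mul_prod_erase _ _ hj, ← Finset.mul_prod_erase _ _ hj', e1, e2,
      Finset.prod_range_succ]
    ring
  · rw [groth_revPerm, ← Finset.mul_prod_erase _ _ hj, ← Finset.mul_prod_erase _ _ hj', e1, e2,
      Finset.prod_range_succ]
    have h1 : ∀ x : MvPolynomial ℕ R, ∏ i' ∈ Finset.range i, oplus (C β) x (C ((r ∘ sTr i) i')) =
        ∏ i' ∈ Finset.range i, oplus (C β) x (C (r i')) := fun x =>
      Finset.prod_congr rfl fun i' hi' => by
        rw [Finset.mem_range] at hi'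
        rw [Function.comp_apply, sTr_apply_ne (by omega) (by omega)]
    have h2 : ∏ j' ∈ ((Finset.range n).erase j).erase (j + 1),
        ∏ i' ∈ Finset.range (n - 1 - j'), oplus (C β) (X j') (C ((r ∘ sTr i) i')) =
        ∏ j' ∈ ((Finset.range n).erase j).erase (j + 1),
        ∏ i' ∈ Finset.range (n - 1 - j'), oplus (C β) (X j') (C (r i')) := by
      refine Finset.prod_congr rfl fun j' hj' => ?_
      simp only [Finset.mem_erase, Finset.mem_range] at hj'
      rcases Nat.lt_or_ge j' j with h | h
      · refine Finset.prod_equiv (sTr i) (fun i' => ?_) (fun i' _ => rfl)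
        rw [Finset.mem_range, Finset.mem_range, sTr_lt_iff (by omega)]
      · refine Finset.prod_congr rfl fun i' hi' => ?_
        rw [Finset.mem_range] at hi'
        rw [Function.comp_apply, sTr_apply_ne (by omega) (by omega)]
    rw [h1, h1, h2, Function.comp_apply, sTr_left]
    ring
  · have hr : ∀ a b, rename (sTr j) (oplus (C β) (X a) (C b) : MvPolynomial ℕ R) =
        oplus (C β) (X (sTr j a)) (C b) := by
      intro a b
      rw [← AlgHom.coe_toRingHom, map_oplus]
      simp
    rw [groth_revPerm, ← Finset.mul_prod_erase _ _ hj, ← Finset.mul_prod_erase _ _ hj', e1, e2,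
      Finset.prod_range_succ]
    simp only [map_mul, map_prod, hr, sTr_left, sTr_right]
    have h2 : ∏ j' ∈ ((Finset.range n).erase j).erase (j + 1),
        ∏ i' ∈ Finset.range (n - 1 - j'), oplus (C β) (X (sTr j j')) (C (r i')) =
        ∏ j' ∈ ((Finset.range n).erase j).erase (j + 1),
        ∏ i' ∈ Finset.range (n - 1 - j'), oplus (C β) (X j') (C (r i')) := by
      refine Finset.prod_congr rfl fun j' hj' => ?_
      simp only [Finset.mem_erase, Finset.mem_range] at hj'
      rw [sTr_apply_ne (by omega) (by omega)]
    rw [h2]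
    ring

lemma revPerm_mul_sTr {n i j : ℕ} (hij : i + j + 2 = n) :
    revPerm n * sTr j = sTr i * revPerm n := by
  ext a
  simp only [Equiv.Perm.mul_apply]
  have h : ∀ a, revPerm n a = if a < n then n - 1 - a else a := fun _ => rfl
  simp only [h, sTr_apply]
  split_ifs <;> omega

/-! ### Vanishing -/

section
variable {R : Type*} [CommRing R] [IsDomain R]

lemma eval_groth_eq_zero (β : R) {n : ℕ} {t s : ℕ → R} (hs : Function.Injective s)
    (hts : ∀ j, oplus β (t j) (s j) = 0) {v : Equiv.Perm ℕ} (hv : InSn n v) :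
    ∀ σ : Equiv.Perm ℕ, InSn n σ → (inversions n σ).card < (inversions n v⁻¹).card →
      eval t (groth β n (s ∘ σ) v) = 0 := by
  refine left_weak_induction (n := n) (P := fun v => ∀ σ : Equiv.Perm ℕ, InSn n σ →
    (inversions n σ).card < (inversions n v⁻¹).card → eval t (groth β n (s ∘ σ) v) = 0) ?_ ?_ hv
  · intro σ hσ hlt
    have hne : ¬ ∀ i < n, n - 1 - i ≤ σ i := by
      intro h
      rw [eq_revPerm_of_le hσ h, revPerm_inv] at hlt
      exact lt_irrefl _ hlt
    push Not at hne
    obtain ⟨i, hi, hlt'⟩ := hne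
    rw [groth_revPerm, map_prod]
    refine Finset.prod_eq_zero (i := σ i) (by simp; omega) ?_
    rw [map_prod]
    refine Finset.prod_eq_zero (i := i) (by simp; omega) ?_
    rw [map_oplus]
    simpa using hts (σ i)
  · intro w i hw hi hdes ih σ hσ hlt
    have e : (sTr i * w)⁻¹ = w⁻¹ * sTr i := by rw [mul_inv_rev, sTr_inv]
    have hc := card_inversions_mul_sTr (w := w⁻¹ * sTr i) hi (by
      rw [Equiv.Perm.mul_apply, Equiv.Perm.mul_apply, sTr_left, sTr_right]; exact hdes)
    rw [mul_assoc, sTr_mul_self, mul_one] at hc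
    rw [e] at hlt
    have hle := card_inversions_mul_sTr_le σ hi
    have h1 := ih σ hσ (by omega)
    have h2 := ih (σ * sTr i) (hσ.mul (InSn.sTr hi)) (by omega)
    have key := congrArg (eval t) (groth_left_of_gt β n (s ∘ σ) hw hi hdes)
    rw [show (s ∘ σ) ∘ sTr i = s ∘ (σ * sTr i) from rfl, map_mul, eval_C,
      map_sub (eval t) (C (1 + β * _) * _), map_mul (eval t), map_mul (eval t), h1, h2,
      mul_zero, mul_zero, sub_zero] at key
    refine (mul_eq_zero.mp key).resolve_left (sub_ne_zero.mpr fun h => ?_)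
    have := σ.injective (hs h)
    omega

lemma eval_groth_self (β : R) {n : ℕ} {t s : ℕ → R} (hs : Function.Injective s)
    (hts : ∀ j, oplus β (t j) (s j) = 0) {v : Equiv.Perm ℕ} (hv : InSn n v) (h1 : v ≠ 1) :
    eval t (groth β n s v) = 0 := by
  have := eval_groth_eq_zero β hs hts hv 1 (InSn.one n) (by
    rw [inversions_one, Finset.card_empty]
    exact card_inversions_pos hv.inv (by simpa using h1))
  exact this

/-! ### Right Demazure recursion -/

/-- Right Demazure recursion. -/
lemma groth_right (β : R) {n : ℕ} {w : Equiv.Perm ℕ} (hw : InSn n w) :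
    ∀ (r : ℕ → R), Function.Injective r → ∀ j, j + 1 < n → w (j + 1) < w j →
      (X j - X (j + 1)) * groth β n r (w * sTr j) =
        (1 + C β * X (j + 1)) * groth β n r w -
          (1 + C β * X j) * rename (sTr j) (groth β n r w) := by
  refine left_weak_induction (n := n) (P := fun w => ∀ (r : ℕ → R), Function.Injective r →
    ∀ j, j + 1 < n → w (j + 1) < w j → (X j - X (j + 1)) * groth β n r (w * sTr j) =
        (1 + C β * X (j + 1)) * groth β n r w -
          (1 + C β * X j) * rename (sTr j) (groth β n r w)) ?_ ?_ hw
  · intro r hr j hj _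
    obtain ⟨i, hij⟩ : ∃ i, i + j + 2 = n := ⟨n - 2 - j, by omega⟩
    obtain ⟨Q, h1, h2, h3⟩ := groth_revPerm_factor β hij r
    have hd : (C (r i - r (i + 1)) : MvPolynomial ℕ R) ≠ 0 := by
      rw [Ne, C_eq_zero, sub_eq_zero]
      intro e
      have := hr e
      omega
    have hL := groth_left_of_gt β n r (InSn.revPerm n) (i := i) (by omega) (by
      rw [revPerm_inv, revPerm_apply (by omega), revPerm_apply (by omega)]; omega)
    rw [h3, h1, revPerm_mul_sTr hij]
    rw [h1, h2] at hL
    have hQ : groth β n r (sTr i * revPerm n) = Q := by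
      refine mul_left_cancel₀ hd ?_
      rw [hL]
      simp only [oplus, map_add, map_sub, map_mul, map_one]
      ring
    rw [hQ]
    simp only [oplus]
    ring
  · intro w' i hw' hi hdes ih r hr j hj hwj
    have hdes' : w' (j + 1) < w' j := by
      by_contra hcon
      have hlt : w' j < w' (j + 1) :=
        lt_of_le_of_ne (not_lt.mp hcon) fun e => by simpa using w'.injective e
      simp only [Equiv.Perm.mul_apply] at hwj
      have h1 : w' j = i ∧ w' (j + 1) = i + 1 := by
        by_contra h
        exact lt_asymm hwj (sTr_lt_sTr hlt h)
      have h2 : w'⁻¹ i = j := by rw [← h1.1]; simp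
      have h3 : w'⁻¹ (i + 1) = j + 1 := by rw [← h1.2]; simp
      omega
    have hdes2 : (w' * sTr j)⁻¹ (i + 1) < (w' * sTr j)⁻¹ i := by
      rw [mul_inv_rev, sTr_inv, Equiv.Perm.mul_apply, Equiv.Perm.mul_apply]
      refine sTr_lt_sTr hdes ?_
      rintro ⟨h1, h2⟩
      rw [Equiv.Perm.inv_eq_iff_eq] at h1 h2
      rw [Equiv.Perm.mul_apply, Equiv.Perm.mul_apply, ← h1, ← h2, sTr_left, sTr_right] at hwj
      omega
    have hd : (C (r i - r (i + 1)) : MvPolynomial ℕ R) ≠ 0 := by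
      rw [Ne, C_eq_zero, sub_eq_zero]
      intro e
      have := hr e
      omega
    have L1 := groth_left_of_gt β n r hw' hi hdes
    have L2 := groth_left_of_gt β n r (hw'.mul (InSn.sTr hj)) hi hdes2
    have L3 := congrArg (rename (sTr j)) L1
    simp only [map_mul, map_sub, rename_C] at L3
    have R1 := ih r hr j hj hdes'
    have R2 := ih (r ∘ sTr i) (hr.comp (sTr i).injective) j hj hdes'
    refine mul_left_cancel₀ hd ?_
    rw [mul_assoc (sTr i)]
    simp only [map_sub] at L1 L2 L3 ⊢
    linear_combination (X j - X (j + 1)) * L2 + C (1 + β * r (i + 1)) * R1 -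
      C (1 + β * r i) * R2 - (1 + C β * X (j + 1)) * L1 + (1 + C β * X j) * L3

end

/-! ### Divided differences -/

lemma exists_divDiff {R : Type*} [CommRing R] (i : ℕ) (f : MvPolynomial ℕ R) :
    ∃ q : MvPolynomial ℕ R, (X i - X (i + 1)) * q = f - rename (sTr i) f := by
  induction f using MvPolynomial.induction_on with
  | C a => exact ⟨0, by simp⟩
  | add p q hp hq =>
    obtain ⟨a, ha⟩ := hp
    obtain ⟨b, hb⟩ := hq
    exact ⟨a + b, by rw [mul_add, ha, hb, map_add]; ring⟩
  | mul_X p j hp =>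
    obtain ⟨a, ha⟩ := hp
    rw [map_mul, rename_X]
    rcases eq_or_ne j i with rfl | h1
    · refine ⟨a * X (j + 1) + p, ?_⟩
      rw [sTr_left]
      linear_combination X (j + 1) * ha
    rcases eq_or_ne j (i + 1) with rfl | h2
    · refine ⟨a * X i - p, ?_⟩
      rw [sTr_right]
      linear_combination X i * ha
    · refine ⟨a * X j, ?_⟩
      rw [sTr_apply_ne h1 h2]
      linear_combination X j * ha

section
variable {R : Type*} [CommRing R] [IsDomain R]

lemma X_sub_X_succ_ne_zero (i : ℕ) : (X i - X (i + 1) : MvPolynomial ℕ R) ≠ 0 := by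
  rw [sub_ne_zero]
  intro h
  have := X_injective h
  omega

/-- The divided difference operator `f ↦ (f - s_i f) / (x_i - x_{i+1})`. -/
def divDiff (i : ℕ) : MvPolynomial ℕ R →ₗ[R] MvPolynomial ℕ R where
  toFun f := (exists_divDiff i f).choose
  map_add' f g := by
    refine mul_left_cancel₀ (X_sub_X_succ_ne_zero i) ?_
    rw [mul_add, (exists_divDiff i _).choose_spec, (exists_divDiff i _).choose_spec,
      (exists_divDiff i _).choose_spec, map_add]
    ring
  map_smul' a f := by
    refine mul_left_cancel₀ (X_sub_X_succ_ne_zero i) ?_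
    rw [RingHom.id_apply, mul_smul_comm, (exists_divDiff i _).choose_spec,
      (exists_divDiff i _).choose_spec, map_smul, smul_sub]

lemma mul_divDiff (i : ℕ) (f : MvPolynomial ℕ R) :
    (X i - X (i + 1)) * divDiff i f = f - rename (sTr i) f :=
  (exists_divDiff i f).choose_spec

/-- The composition of the operators `f ↦ (1 + β x_i) (f - s_i f) / (x_i - x_{i+1})` along a
word. -/
def demazureWord (β : R) : List ℕ → MvPolynomial ℕ R →ₗ[R] MvPolynomial ℕ R
  | [] => LinearMap.id
  | i :: l => LinearMap.mulLeft R (1 + C β * X i) ∘ₗ divDiff i ∘ₗ demazureWord β l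

lemma demazureWord_cons (β : R) (i : ℕ) (l : List ℕ) (f : MvPolynomial ℕ R) :
    demazureWord β (i :: l) f = (1 + C β * X i) * divDiff i (demazureWord β l f) := rfl

lemma eval_demazureWord_cons (β : R) (i : ℕ) (l : List ℕ) (f : MvPolynomial ℕ R) (t : ℕ → R) :
    (t i - t (i + 1)) * eval t (demazureWord β (i :: l) f) =
      (1 + β * t i) *
        (eval t (demazureWord β l f) - eval (t ∘ sTr i) (demazureWord β l f)) := by
  have h := congrArg (eval t) (mul_divDiff i (demazureWord β l f))
  rw [map_mul, map_sub, map_sub, eval_X, eval_X, eval_rename] at h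
  rw [demazureWord_cons, map_mul, ← h]
  simp only [map_add, map_mul, map_one, eval_C, eval_X]
  ring

lemma map_demazureWord {S : Type*} [CommRing S] [IsDomain S] (ρ : R →+* S) (β : R) (l : List ℕ)
    (f : MvPolynomial ℕ R) :
    map ρ (demazureWord β l f) = demazureWord (ρ β) l (map ρ f) := by
  induction l with
  | nil => rfl
  | cons i l ih =>
    rw [demazureWord_cons, demazureWord_cons, map_mul, ← ih]
    congr 1
    · simp
    · refine mul_left_cancel₀ (X_sub_X_succ_ne_zero i) ?_
      rw [mul_divDiff, ← map_rename, ← map_sub, ← mul_divDiff, map_mul, map_sub, map_X, map_X]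

end

/-- `LeftWord n w l` says that `l` is a word for `w`, with letters `< n - 1`, all of whose suffixes
are reduced. -/
inductive LeftWord (n : ℕ) : Equiv.Perm ℕ → List ℕ → Prop
  | nil : LeftWord n 1 []
  | cons {w : Equiv.Perm ℕ} {l : List ℕ} {i : ℕ} : LeftWord n w l → i + 1 < n →
      w⁻¹ i < w⁻¹ (i + 1) → LeftWord n (sTr i * w) (i :: l)

lemma LeftWord.mono {n m : ℕ} (h : n ≤ m) {w : Equiv.Perm ℕ} {l : List ℕ} (hl : LeftWord n w l) :
    LeftWord m w l := by
  induction hl with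
  | nil => exact .nil
  | cons _ hi hlt ih => exact .cons ih (by omega) hlt

lemma exists_leftWord {n : ℕ} {w : Equiv.Perm ℕ} (hw : InSn n w) :
    ∃ l, LeftWord n w l := by
  induction hm : (inversions n w⁻¹).card using Nat.strong_induction_on generalizing w with
  | _ m ih =>
    by_cases h1 : w = 1
    · exact ⟨[], h1 ▸ .nil⟩
    obtain ⟨⟨a, b⟩, hab⟩ := Finset.card_pos.mp (card_inversions_pos hw.inv (by simpa using h1))
    rw [mem_inversions] at hab
    have hex : ∃ i, i + 1 < n ∧ w⁻¹ (i + 1) < w⁻¹ i := by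
      by_contra hcon
      push Not at hcon
      have : ∀ d, a + d < n → w⁻¹ a ≤ w⁻¹ (a + d) := by
        intro d
        induction d with
        | zero => simp
        | succ d ihd => exact fun h => (ihd (by omega)).trans (hcon (a + d) (by omega))
      have := this (b - a) (by omega)
      rw [show a + (b - a) = b by omega] at this
      omega
    obtain ⟨i, hi, hlt⟩ := hex
    have e : (sTr i * w)⁻¹ = w⁻¹ * sTr i := by rw [mul_inv_rev, sTr_inv]
    have hlt' : (sTr i * w)⁻¹ i < (sTr i * w)⁻¹ (i + 1) := by
      rw [e, Equiv.Perm.mul_apply, Equiv.Perm.mul_apply, sTr_left, sTr_right]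
      exact hlt
    have hc := card_inversions_mul_sTr (w := w⁻¹ * sTr i) hi (e ▸ hlt')
    rw [mul_assoc, sTr_mul_self, mul_one] at hc
    obtain ⟨l, hl⟩ := ih _ (by rw [← hm, e]; omega) ((InSn.sTr hi).mul hw) rfl
    refine ⟨i :: l, ?_⟩
    have := LeftWord.cons hl hi hlt'
    rwa [← mul_assoc, sTr_mul_self, one_mul] at this

section
variable {R : Type*} [CommRing R] [IsDomain R]

lemma eval_demazureWord (β : R) {n k : ℕ} (A : MvPolynomial ℕ R)
    (P : Equiv.Perm ℕ → (ℕ → R) → Equiv.Perm ℕ → R)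
    (base : ∀ v t s, Function.Injective s → (∀ j, oplus β (t j) (s j) = 0) → InSn n v →
      (∀ i, i + 1 < k → v i ≤ v (i + 1)) → eval t (A * groth β n s v) = P v t 1)
    (hgt : ∀ v t w j, (∀ i, i + 1 < k → v i ≤ v (i + 1)) → j + 1 < n → w⁻¹ j < w⁻¹ (j + 1) →
      v⁻¹ (j + 1) < v⁻¹ j →
      (t j - t (j + 1)) * (P v t (sTr j * w) - P (sTr j * v) (t ∘ sTr j) w) =
        (1 + β * t j) * P v t w - (1 + β * t (j + 1)) * P v (t ∘ sTr j) w)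
    (hlt : ∀ v t w j, j + 1 < n → w⁻¹ j < w⁻¹ (j + 1) → v⁻¹ j < v⁻¹ (j + 1) →
      (t j - t (j + 1)) * P v t (sTr j * w) = (1 + β * t j) * (P v t w - P v (t ∘ sTr j) w))
    {w : Equiv.Perm ℕ} {l : List ℕ} (hl : LeftWord n w l) :
    ∀ v t s, Function.Injective t → Function.Injective s → (∀ j, oplus β (t j) (s j) = 0) →
      InSn n v → (∀ i, i + 1 < k → v i ≤ v (i + 1)) →
      eval t (demazureWord β l (A * groth β n s v)) = P v t w := by
  induction hl with
  | nil => exact fun v t s _ hs hts hv hvk => base v t s hs hts hv hvk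
  | @cons w l j _ hj hwj ih =>
    intro v t s ht hs hts hv hvk
    have htj : t j - t (j + 1) ≠ 0 := sub_ne_zero.mpr fun h => by simpa using ht h
    have hts' : ∀ i, oplus β ((t ∘ sTr j) i) ((s ∘ sTr j) i) = 0 := fun i => hts _
    have ht' := ht.comp (sTr j).injective
    have hs' := hs.comp (sTr j).injective
    have hu : ∀ i, (1 + β * t i) * (1 + β * s i) = 1 := fun i => by
      have := hts i
      rw [oplus] at this
      linear_combination β * this
    refine mul_left_cancel₀ htj ?_
    rw [eval_demazureWord_cons, ih v t s ht hs hts hv hvk]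
    rcases lt_or_gt_of_ne (fun h => by simpa using v⁻¹.injective h : v⁻¹ j ≠ v⁻¹ (j + 1))
      with hvj | hvj
    · rw [hlt v t w j hj hwj hvj,
        ← groth_left_of_lt β n s hv hj hvj (IsUnit.of_mul_eq_one_right _ (hu j)),
        ih v _ _ ht' hs' hts' hv hvk]
    · have hvk' : ∀ i, i + 1 < k → (sTr j * v) i ≤ (sTr j * v) (i + 1) := by
        intro i hi
        have h1 := lt_of_le_of_ne (hvk i hi) fun e => by simpa using v.injective e
        refine (sTr_lt_sTr h1 ?_).le
        rintro ⟨h2, h3⟩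
        have h4 : v⁻¹ j = i := by rw [← h2]; simp
        have h5 : v⁻¹ (j + 1) = i + 1 := by rw [← h3]; simp
        omega
      have L := groth_left_of_gt β n (s ∘ sTr j) hv hj hvj
      rw [show (s ∘ sTr j) ∘ sTr j = s from funext fun i => congrArg s (sTr_sTr j i),
        Function.comp_apply, Function.comp_apply, sTr_left, sTr_right, ← smul_eq_C_mul,
        ← smul_eq_C_mul, ← smul_eq_C_mul] at L
      have L' := congrArg (fun f => eval (t ∘ sTr j) (demazureWord β l (A * f))) L
      simp only [mul_sub, mul_smul_comm, map_sub, map_smul, smul_eval] at L'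
      rw [ih v _ _ ht' hs' hts' hv hvk,
        ih _ _ _ ht' hs' hts' ((InSn.sTr hj).mul hv) hvk'] at L'
      have h0 := hgt v t w j hvk hj hwj hvj
      have ej := hts j
      have ej' := hts (j + 1)
      rw [oplus] at ej ej'
      linear_combination -h0 - (1 + β * t j) * (1 + β * t (j + 1)) * L' +
        P (sTr j * v) (t ∘ sTr j) w * ((1 + β * t j) * ej' - (1 + β * t (j + 1)) * ej) -
        P v (t ∘ sTr j) w * (1 + β * t (j + 1)) * hu j +
        eval (t ∘ sTr j) (demazureWord β l (A * groth β n s v)) * (1 + β * t j) * hu (j + 1)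

end

section
variable {R : Type*} [CommRing R] [IsDomain R]

lemma eval_demazureWord_groth_mul (β : R) {n k : ℕ} (hk : k ≤ n) {t r s : ℕ → R}
    (ht : Function.Injective t) (hs : Function.Injective s) (hts : ∀ j, oplus β (t j) (s j) = 0)
    {u v w : Equiv.Perm ℕ} (hun : InSn n u) (hu : ∀ i, k ≤ i → u i ≤ u (i + 1))
    (hvn : InSn n v) (hv : ∀ i, i + 1 < k → v i ≤ v (i + 1)) {l : List ℕ} (hl : LeftWord n w l) :
    eval t (demazureWord β l (groth β n r u * groth β n s v)) =
      puzzleSum β n k t r u v w := by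
  refine eval_demazureWord β (k := k) (groth β n r u)
    (fun v t w => puzzleSum β n k t r u v w) ?_ ?_ ?_ hl v t s ht hs hts hvn hv
  · intro v t s hs hts hvn hv
    by_cases h1 : v = 1
    · rw [h1, groth_one, mul_one, puzzleSum_one_one β hk t r hun hu]
    · rw [puzzleSum_one_of_ne β t r u hvn hv h1, map_mul, eval_groth_self β hs hts hvn h1,
        mul_zero]
  · intro v t w j hv hj hw hvj
    exact puzzleSum_of_gt β n k t r u hv hj hw hvj
  · intro v t w j hj hw hvj
    exact puzzleSum_of_lt β n k t r u hj hw hvj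

lemma eval_demazureWord_groth [DecidableEq (Equiv.Perm ℕ)] (β : R) {n : ℕ} {t s : ℕ → R}
    (ht : Function.Injective t) (hs : Function.Injective s) (hts : ∀ j, oplus β (t j) (s j) = 0)
    {v w : Equiv.Perm ℕ} (hvn : InSn n v) {l : List ℕ} (hl : LeftWord n w l) :
    eval t (demazureWord β l (groth β n s v)) = if v = w then 1 else 0 := by
  rw [← one_mul (groth β n s v)]
  refine eval_demazureWord β (k := 0) 1 (fun v _ w => if v = w then 1 else 0) ?_ ?_ ?_ hl
    v t s ht hs hts hvn (by simp)
  · intro v t s hs hts hvn _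
    rw [one_mul]
    split_ifs with h1
    · rw [h1, groth_one, map_one]
    · exact eval_groth_self β hs hts hvn h1
  · intro v t w j _ hj hw hvj
    have h1 : v ≠ w := by
      rintro rfl
      omega
    have h2 : v = sTr j * w ↔ sTr j * v = w := by
      rw [← mul_right_inj (sTr j), ← mul_assoc, sTr_mul_self, one_mul]
    simp only [h1, h2]
    simp
  · intro v t w j hj hw hvj
    have h1 : v ≠ sTr j * w := by
      rintro rfl
      rw [mul_inv_rev, sTr_inv, Equiv.Perm.mul_apply, Equiv.Perm.mul_apply, sTr_left,
        sTr_right] at hvj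
      omega
    simp [h1]

end

/-! ### Specialization to arbitrary parameters -/

section
variable {K : Type*} [Field K]

/-- A deformation of a sequence of scalars to a sequence of pairwise distinct power series. -/
def deform (r : ℕ → K) (j : ℕ) : PowerSeries K := PowerSeries.C (r j) + PowerSeries.X ^ (j + 1)

lemma constantCoeff_deform (r : ℕ → K) : PowerSeries.constantCoeff ∘ deform r = r := by
  ext j
  simp [deform]

lemma deform_injective (r : ℕ → K) : Function.Injective (deform r) := by
  intro i j h
  by_contra hij
  have := congrArg (PowerSeries.coeff (i + 1)) h
  simp [deform, PowerSeries.coeff_X_pow, hij] at this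

lemma exists_oplus_inverse (β : K) {t : ℕ → K} (ht : ∀ j, 1 + β * t j ≠ 0) :
    ∃ s : ℕ → PowerSeries K, Function.Injective s ∧
      (∀ j, oplus (PowerSeries.C β) (deform t j) (s j) = 0) ∧
      PowerSeries.constantCoeff ∘ s = fun j => ominus β 0 (t j) := by
  have hc : ∀ j, PowerSeries.constantCoeff (1 + PowerSeries.C β * deform t j) = 1 + β * t j := by
    intro j
    simp [deform]
  have hinv : ∀ j, (1 + PowerSeries.C β * deform t j) * (1 + PowerSeries.C β * deform t j)⁻¹ = 1 :=
    fun j => PowerSeries.mul_inv_cancel _ (by rw [hc]; exact ht j)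
  have hts : ∀ j, oplus (PowerSeries.C β) (deform t j)
      (-deform t j * (1 + PowerSeries.C β * deform t j)⁻¹) = 0 := by
    intro j
    rw [oplus]
    linear_combination -deform t j * hinv j
  refine ⟨fun j => -deform t j * (1 + PowerSeries.C β * deform t j)⁻¹, ?_, hts, ?_⟩
  · intro i j h
    refine deform_injective t ?_
    dsimp only at h
    have hi := hts i
    have hj := hts j
    rw [h] at hi
    rw [oplus] at hi hj
    generalize -deform t j * (1 + PowerSeries.C β * deform t j)⁻¹ = s at *
    have hu : (1 + PowerSeries.C β * deform t j) * (1 + PowerSeries.C β * s) = 1 := by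
      linear_combination PowerSeries.C β * hj
    refine mul_right_cancel₀ (right_ne_zero_of_mul (hu.trans_ne one_ne_zero)) ?_
    linear_combination hi - hj
  · ext j
    rw [Function.comp_apply, map_mul, PowerSeries.constantCoeff_inv, hc, map_neg,
      show PowerSeries.constantCoeff (deform t j) = t j from congrFun (constantCoeff_deform t) j,
      ominus, zero_sub, div_eq_mul_inv]

lemma constantCoeff_eval (t : ℕ → PowerSeries K) (f : MvPolynomial ℕ (PowerSeries K)) :
    PowerSeries.constantCoeff (eval t f) =
      eval (PowerSeries.constantCoeff ∘ t) (map PowerSeries.constantCoeff f) := by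
  rw [eval_map, ← eval₂_id, eval₂_comp_left, RingHom.comp_id]

lemma field_eval_demazureWord_groth_mul (β : K) {n k : ℕ} (hk : k ≤ n) {t : ℕ → K} (r : ℕ → K)
    (ht : ∀ j, 1 + β * t j ≠ 0)
    {u v w : Equiv.Perm ℕ} (hun : InSn n u) (hu : ∀ i, k ≤ i → u i ≤ u (i + 1))
    (hvn : InSn n v) (hv : ∀ i, i + 1 < k → v i ≤ v (i + 1)) {l : List ℕ} (hl : LeftWord n w l) :
    eval t (demazureWord β l (groth β n r u * groth β n (fun j => ominus β 0 (t j)) v)) =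
      puzzleSum β n k t r u v w := by
  obtain ⟨s, hs, hts, hs0⟩ := exists_oplus_inverse β ht
  have h := congrArg PowerSeries.constantCoeff (eval_demazureWord_groth_mul (PowerSeries.C β) hk
    (r := deform r) (deform_injective t) hs hts hun hu hvn hv hl)
  rwa [map_puzzleSum, constantCoeff_eval, map_demazureWord, map_mul, map_groth, map_groth, hs0,
    constantCoeff_deform, constantCoeff_deform, PowerSeries.constantCoeff_C] at h

lemma field_eval_demazureWord_groth [DecidableEq (Equiv.Perm ℕ)] (β : K) {n : ℕ} {t : ℕ → K}
    (ht : ∀ j, 1 + β * t j ≠ 0)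
    {v w : Equiv.Perm ℕ} (hvn : InSn n v) {l : List ℕ} (hl : LeftWord n w l) :
    eval t (demazureWord β l (groth β n (fun j => ominus β 0 (t j)) v)) =
      if v = w then 1 else 0 := by
  obtain ⟨s, hs, hts, hs0⟩ := exists_oplus_inverse β ht
  have h := congrArg PowerSeries.constantCoeff (eval_demazureWord_groth (PowerSeries.C β)
    (deform_injective t) hs hts hvn hl)
  rw [constantCoeff_eval, map_demazureWord, map_groth, hs0,
    constantCoeff_deform, PowerSeries.constantCoeff_C] at h
  rw [h]
  split_ifs <;> simp

lemma field_groth_right (β : K) {n : ℕ} {w : Equiv.Perm ℕ} (hw : InSn n w)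
    (r : ℕ → K) {j : ℕ} (hj : j + 1 < n) (hdes : w (j + 1) < w j) :
    (X j - X (j + 1)) * groth β n r (w * sTr j) =
      (1 + C β * X (j + 1)) * groth β n r w -
        (1 + C β * X j) * rename (sTr j) (groth β n r w) := by
  have h := congrArg (map PowerSeries.constantCoeff)
    (groth_right (PowerSeries.C β) hw (deform r) (deform_injective r) j hj hdes)
  simpa only [map_mul, map_sub, map_add, map_one, map_X, map_C, map_rename, map_groth,
    constantCoeff_deform, PowerSeries.constantCoeff_C] using h

lemma GrothFamily.eq_groth {β : K} {G : (ℕ → K) → Equiv.Perm ℕ → MvPolynomial ℕ K}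
    (hG : GrothFamily β G) {t : ℕ → K} (ht : ∀ j, 1 + β * t j ≠ 0) {n : ℕ}
    {w : Equiv.Perm ℕ} (hw : InSn n w) :
    G t w = groth β n (fun j => ominus β 0 (t j)) w := by
  rw [← inv_inv w]
  refine left_weak_induction (n := n)
    (P := fun w => G t w⁻¹ = groth β n (fun j => ominus β 0 (t j)) w⁻¹) ?_ ?_ hw.inv
  · rw [revPerm_inv, (hG t ht).1 n, groth_revPerm]
    refine Finset.prod_congr rfl fun i _ => Finset.prod_congr rfl fun j _ => ?_
    have e : (1 + β * t j)⁻¹ * (1 + β * t j) = 1 := inv_mul_cancel₀ (ht j)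
    have e' : (C (1 + β * t j)⁻¹ : MvPolynomial ℕ K) * (1 + C β * C (t j)) = 1 := by
      rw [← C_mul, ← C_1, ← C_add, ← C_mul, e]
    rw [oplus, ominus, zero_sub, div_eq_mul_inv, C_mul, C_neg]
    linear_combination X i * e'
  · intro w i hw hi hdes ih
    refine mul_left_cancel₀ (X_sub_X_succ_ne_zero i) ?_
    rw [mul_inv_rev, sTr_inv, field_groth_right β hw.inv _ hi hdes, (hG t ht).2 _ _ hdes, ih]
    rfl

lemma structConsts_eq_puzzleSum {β : K} {G : (ℕ → K) → Equiv.Perm ℕ → MvPolynomial ℕ K}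
    {c : (ℕ → K) → (ℕ → K) → Equiv.Perm ℕ → Equiv.Perm ℕ → Equiv.Perm ℕ → K}
    (hG : GrothFamily β G) (hc : StructConsts β G c) {n k : ℕ} (hk : k ≤ n)
    {u v w : Equiv.Perm ℕ} (hu : InSn n u) (hv : InSn n v) (hw : InSn n w) (hsep : SepDesc k u v)
    {t y : ℕ → K} (ht : ∀ j, 1 + β * t j ≠ 0) (hy : ∀ j, 1 + β * y j ≠ 0) :
    c t y u v w = puzzleSum β n k t (fun i => ominus β 0 (y i)) u v w := by
  classical
  obtain ⟨hfin, hzero, hexp⟩ := hc t y ht hy u v ⟨n, hu⟩ ⟨n, hv⟩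
  obtain ⟨l, hl⟩ := exists_leftWord hw
  rw [← field_eval_demazureWord_groth_mul β hk _ ht hu hsep.1 hv hsep.2 hl,
    ← hG.eq_groth hy hu, ← hG.eq_groth ht hv, hexp,
    finsum_eq_sum_of_support_subset (s := hfin.toFinset) _ (by
      intro σ hσ
      simp only [Set.Finite.coe_toFinset, Set.mem_ofPred_eq]
      intro h0
      simp [h0] at hσ),
    map_sum, map_sum]
  have hterm : ∀ σ, c t y u v σ ≠ 0 →
      eval t (demazureWord β l (G t σ)) = if σ = w then 1 else 0 := by
    intro σ hσ
    have hfp : FinPerm σ := by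
      by_contra h
      exact hσ (hzero σ h)
    obtain ⟨N, hN⟩ := hfp
    have hN' : InSn (max n N) σ := fun j hj => hN j ((le_max_right _ _).trans hj)
    rw [hG.eq_groth ht hN', field_eval_demazureWord_groth β ht hN' (hl.mono (le_max_left _ _))]
  have hsum : ∀ σ ∈ hfin.toFinset, eval t (demazureWord β l (C (c t y u v σ) * G t σ)) =
      if σ = w then c t y u v σ else 0 := by
    intro σ hσ
    rw [← smul_eq_C_mul, map_smul, smul_eval, hterm σ (by simpa using hσ), mul_ite, mul_one,
      mul_zero]
  rw [Finset.sum_congr rfl hsum, Finset.sum_ite_eq' hfin.toFinset w]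
  split_ifs with h
  · rfl
  · simpa using h

end

/-! ### Expansion of the operators over states -/

section
variable {K : Type*} [Field K]

lemma Lwt_eq (β x : K) (k N E W S : ℕ) :
    Lwt β k x N E W S =
      (if W = E ∧ S = N then passWt x N E else 0) +
        (if W = N ∧ S = E then turnWt (fun a => decide (a ≤ k)) β x N E else 0) := by
  unfold Lwt passWt turnWt
  grind

lemma Lwt_of_not_lAdm (β x : K) {k N E W S : ℕ} (h : ¬ LAdm k N E W S) :
    Lwt β k x N E W S = 0 := by
  simp only [LAdm, not_or] at h
  obtain ⟨h1, h2, h3, h4, h5, h6, h7, h8, h9, h10, h11⟩ := h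
  rw [Lwt, if_neg h1, if_neg h2, if_neg h3, if_neg h4, if_neg h5, if_neg h6, if_neg h7, if_neg h8,
    if_neg h9, if_neg h10, if_neg h11]

lemma tileOp_eq_sum (β x : K) (k B i j : ℕ) (φ : Lines → K) {f : Lines}
    (hj : f (Sum.inr j) < B) (hi : f (Sum.inl i) < B) :
    tileOp (fun a => decide (a ≤ k)) β x i j φ f =
      ∑ W : Fin B, ∑ S : Fin B, Lwt β k x (f (Sum.inr j)) (f (Sum.inl i)) W S *
        φ (Function.update (Function.update f (Sum.inl i) W) (Sum.inr j) S) := by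
  obtain ⟨N, hN⟩ : ∃ N : Fin B, f (Sum.inr j) = N := ⟨⟨_, hj⟩, rfl⟩
  obtain ⟨E, hE⟩ : ∃ E : Fin B, f (Sum.inl i) = E := ⟨⟨_, hi⟩, rfl⟩
  have e1 : Function.update (Function.update f (Sum.inl i) E) (Sum.inr j) N = f := by
    rw [← hE, Function.update_eq_self, ← hN, Function.update_eq_self]
  have e2 : Function.update (Function.update f (Sum.inl i) N) (Sum.inr j) E =
      f ∘ Equiv.swap (Sum.inr j) (Sum.inl i) := by
    ext z
    simp only [Function.comp_apply, Equiv.swap_apply_def, Function.update_apply]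
    split_ifs <;> simp_all
  simp only [tileOp, lineOp_apply, hN, hE, Lwt_eq, add_mul, Finset.sum_add_distrib, Fin.val_inj,
    ite_and, ite_mul, zero_mul, Finset.sum_ite_eq', Finset.sum_ite_irrel, Finset.sum_const_zero,
    Finset.mem_univ, if_true, e1, e2]

lemma sum_fin_snoc {α M : Type*} [Fintype α] [AddCommMonoid M] {m : ℕ} (F : (Fin (m + 1) → α) → M) :
    ∑ e, F e = ∑ e : Fin m → α, ∑ a : α, F (Fin.snoc (α := fun _ => α) e a) := by
  rw [← (Fin.snocEquiv (fun _ : Fin (m + 1) => α)).sum_comp, Fintype.sum_prod_type, Finset.sum_comm]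
  rfl

/-- Override the labels of the first `m` horizontal lines. -/
def setRows {m : ℕ} (e : Fin m → ℕ) (f : Lines) : Lines :=
  Sum.elim (fun i => if h : i < m then e ⟨i, h⟩ else f (Sum.inl i)) (f ∘ Sum.inr)

/-- Override the labels of the first `c` vertical lines. -/
def setCols {c : ℕ} (e : Fin c → ℕ) (f : Lines) : Lines :=
  Sum.elim (f ∘ Sum.inl) (fun j => if h : j < c then e ⟨j, h⟩ else f (Sum.inr j))

lemma colOp_eq_sum (β : K) (k B : ℕ) (t r : ℕ → K) (j m : ℕ) (φ : Lines → K) {f : Lines}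
    (hj : f (Sum.inr j) < B) (hi : ∀ i < m, f (Sum.inl i) < B) :
    colOp (fun a => decide (a ≤ k)) β t r j m φ f =
      ∑ e : Fin m → Fin B, ∑ a : Fin (m + 1) → Fin B, if (a 0 : ℕ) = f (Sum.inr j) then
        (∏ i : Fin m, Lwt β k (oplus β (t j) (r i)) (a i.castSucc) (f (Sum.inl i)) (e i)
          (a i.succ)) * φ (Function.update (setRows (fun i => (e i : ℕ)) f) (Sum.inr j)
            (a (Fin.last m)))
      else 0 := by
  induction m generalizing φ with
  | zero =>
    obtain ⟨N, hN⟩ : ∃ N : Fin B, f (Sum.inr j) = N := ⟨⟨_, hj⟩, rfl⟩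
    have e1 : ∀ e : Fin 0 → ℕ, Function.update (setRows e f) (Sum.inr j) N = f := by
      intro e
      rw [← hN]
      ext (z | z) <;> simp [setRows, Function.update_apply]
      rintro rfl
      rfl
    rw [Fintype.sum_unique, ← (Equiv.funUnique (Fin 1) (Fin B)).symm.sum_comp]
    simp [colOp, hN, Fin.val_inj, e1]
  | succ m ih =>
    simp only [colOp, Module.End.mul_apply]
    rw [ih _ (fun i h => hi i (by omega)), sum_fin_snoc]
    refine Finset.sum_congr rfl fun e _ => ?_
    simp only [sum_fin_snoc (m := m + 1)]
    rw [Finset.sum_comm]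
    refine Finset.sum_congr rfl fun a _ => ?_
    have h0 : ∀ S : Fin B, Fin.snoc (α := fun _ => Fin B) a S 0 = a 0 := fun S =>
      Fin.snoc_castSucc (α := fun _ => Fin B) (i := 0) ..
    simp only [h0]
    split_ifs with ha
    · rw [tileOp_eq_sum β _ k B m j φ (by simp) (by simpa [setRows] using hi m (by omega)),
        Finset.mul_sum]
      refine Finset.sum_congr rfl fun W _ => ?_
      rw [Finset.mul_sum]
      refine Finset.sum_congr rfl fun S _ => ?_
      have e1 : Function.update (Function.update (Function.update (setRows (fun i => (e i : ℕ)) f)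
          (Sum.inr j) (a (Fin.last m))) (Sum.inl m) W) (Sum.inr j) S =
          Function.update (setRows (fun i =>
            (Fin.snoc (α := fun _ => Fin B) e W i : ℕ)) f) (Sum.inr j) S := by
        ext (z | z)
        · simp only [setRows, Function.update_apply, Fin.snoc,
            Sum.elim_inl, Sum.inl.injEq, reduceCtorEq, if_false]
          split_ifs <;> first | rfl | omega
        · simp only [setRows, Function.update_apply, Sum.inr.injEq, reduceCtorEq, if_false,
            Sum.elim_inr]
          split_ifs <;> rfl
      rw [e1, Fin.prod_univ_castSucc]
      simp only [setRows, mul_assoc, Fin.succ_castSucc, Fin.snoc_castSucc, Fin.snoc_last, Fin.succ_last,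
        Fin.val_castSucc, Fin.val_last, Function.update_self, lt_irrefl, Sum.elim_inl, dite_false,
        Function.update_of_ne, ne_eq, reduceCtorEq, not_false_eq_true]
    · simp

lemma gridOp_eq_sum (β : K) (k B : ℕ) (t r : ℕ → K) (m c : ℕ) (φ : Lines → K) {f : Lines}
    (hi : ∀ i < m, f (Sum.inl i) < B) (hj : ∀ j < c, f (Sum.inr j) < B) :
    gridOp (fun a => decide (a ≤ k)) β t r m c φ f =
      ∑ H : Fin (c + 1) → Fin m → Fin B, ∑ V : Fin c → Fin (m + 1) → Fin B,
        if (∀ i, (H (Fin.last c) i : ℕ) = f (Sum.inl i)) ∧ (∀ j, (V j 0 : ℕ) = f (Sum.inr j)) then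
          (∏ j : Fin c, ∏ i : Fin m, Lwt β k (oplus β (t j) (r i)) (V j i.castSucc) (H j.succ i)
            (H j.castSucc i) (V j i.succ)) *
          φ (setCols (fun j => (V j (Fin.last m) : ℕ)) (setRows (fun i => (H 0 i : ℕ)) f))
        else 0 := by
  obtain ⟨E, hE⟩ : ∃ E : Fin m → Fin B, ∀ i : Fin m, f (Sum.inl i) = E i :=
    ⟨fun i => ⟨f (Sum.inl i), hi i i.isLt⟩, fun i => rfl⟩
  have hE' : ∀ h : Fin m → Fin B, (∀ i, (h i : ℕ) = f (Sum.inl i)) ↔ h = E := by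
    intro h
    simp only [hE, Fin.val_inj, funext_iff]
  induction c generalizing φ f E with
  | zero =>
    have e1 : ∀ e : Fin 0 → ℕ, setCols e (setRows (fun i => (E i : ℕ)) f) = f := by
      intro e
      ext (z | z)
      · simp only [setCols, setRows, Sum.elim_inl, Function.comp_apply]
        split_ifs with h
        · exact (hE ⟨z, h⟩).symm
        · rfl
      · simp [setCols, setRows]
    rw [← (Equiv.funUnique (Fin 1) (Fin m → Fin B)).symm.sum_comp]
    simp [gridOp, hE', e1]
  | succ c ih =>
    simp only [gridOp, Module.End.mul_apply]
    rw [colOp_eq_sum β k B t r c m _ (hj c (by omega)) hi]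
    have hL : ∀ (e : Fin m → Fin B) (a : Fin (m + 1) → Fin B),
        gridOp (fun a => decide (a ≤ k)) β t r m c φ
          (Function.update (setRows (fun i => (e i : ℕ)) f) (Sum.inr c) (a (Fin.last m))) =
        ∑ H : Fin (c + 1) → Fin m → Fin B, if H (Fin.last c) = e then
          ∑ V : Fin c → Fin (m + 1) → Fin B, if ∀ j, (V j 0 : ℕ) = f (Sum.inr j) then
          (∏ j : Fin c, ∏ i : Fin m, Lwt β k (oplus β (t j) (r i)) (V j i.castSucc) (H j.succ i)
            (H j.castSucc i) (V j i.succ)) *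
          φ (setCols (fun j => (Fin.snoc (α := fun _ => Fin (m + 1) → Fin B) V a j
            (Fin.last m) : ℕ)) (setRows (fun i => (H 0 i : ℕ)) f)) else 0 else 0 := by
      intro e a
      have h1 : ∀ i : Fin m, Function.update (setRows (fun i => (e i : ℕ)) f) (Sum.inr c)
          (a (Fin.last m) : ℕ) (Sum.inl i) = e i := by
        intro i
        simp [setRows]
      have h2 : ∀ j < c, Function.update (setRows (fun i => (e i : ℕ)) f) (Sum.inr c)
          (a (Fin.last m) : ℕ) (Sum.inr j) = f (Sum.inr j) := by
        intro j hjc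
        rw [Function.update_of_ne (by simpa using hjc.ne)]
        rfl
      have h3 : ∀ (V : Fin c → Fin (m + 1) → Fin B) (g : Fin m → Fin B),
          setCols (fun j => (V j (Fin.last m) : ℕ)) (setRows (fun i => (g i : ℕ))
            (Function.update (setRows (fun i => (e i : ℕ)) f) (Sum.inr c) (a (Fin.last m)))) =
          setCols (fun j => (Fin.snoc (α := fun _ => Fin (m + 1) → Fin B) V a j
            (Fin.last m) : ℕ)) (setRows (fun i => (g i : ℕ)) f) := by
        intro V g
        ext (z | z)
        · simp only [setRows, setCols, Sum.elim_inl, Function.comp_apply, Function.update_apply,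
            reduceCtorEq, if_false]
          split_ifs <;> rfl
        · simp only [setRows, setCols, Sum.elim_inr, Function.comp_apply, Function.update_apply,
            Sum.inr.injEq, Fin.snoc]
          split_ifs <;> first | rfl | omega
      have h4 : ∀ h : Fin m → Fin B, (∀ i : Fin m, (h i : ℕ) = Function.update
          (setRows (fun i => (e i : ℕ)) f) (Sum.inr c) (a (Fin.last m) : ℕ) (Sum.inl i)) ↔
          h = e := by
        intro h
        simp only [h1, Fin.val_inj, funext_iff]
      rw [ih φ (fun i h => by rw [h1 ⟨i, h⟩]; exact (e _).isLt)
        (fun j h => by rw [h2 j h]; exact hj j (by omega)) e h1 h4]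
      refine Finset.sum_congr rfl fun H _ => ?_
      simp only [h4, h3, h2 _ (Fin.isLt _)]
      split_ifs with hH
      · simp [hH]
      · simp [hH]
    simp only [hL]
    let Q : (Fin (c + 1) → Fin m → Fin B) → (Fin c → Fin (m + 1) → Fin B) →
        (Fin (m + 1) → Fin B) → K := fun H V a =>
      (∏ j : Fin c, ∏ i : Fin m, Lwt β k (oplus β (t j) (r i)) (V j i.castSucc) (H j.succ i)
        (H j.castSucc i) (V j i.succ)) *
      ((∏ i : Fin m, Lwt β k (oplus β (t c) (r i)) (a i.castSucc) (f (Sum.inl i))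
        (H (Fin.last c) i) (a i.succ)) *
      φ (setCols (fun j => (Fin.snoc (α := fun _ => Fin (m + 1) → Fin B) V a j
        (Fin.last m) : ℕ)) (setRows (fun i => (H 0 i : ℕ)) f)))
    trans ∑ H : Fin (c + 1) → Fin m → Fin B, ∑ V : Fin c → Fin (m + 1) → Fin B,
      ∑ a : Fin (m + 1) → Fin B,
        if (∀ j, (V j 0 : ℕ) = f (Sum.inr j)) ∧ (a 0 : ℕ) = f (Sum.inr c) then Q H V a else 0
    · trans ∑ e : Fin m → Fin B, ∑ a : Fin (m + 1) → Fin B, ∑ H : Fin (c + 1) → Fin m → Fin B,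
        if H (Fin.last c) = e then ∑ V : Fin c → Fin (m + 1) → Fin B,
          if (∀ j, (V j 0 : ℕ) = f (Sum.inr j)) ∧ (a 0 : ℕ) = f (Sum.inr c) then Q H V a else 0
        else 0
      · refine Finset.sum_congr rfl fun e _ => Finset.sum_congr rfl fun a _ => ?_
        by_cases ha : (a 0 : ℕ) = f (Sum.inr c)
        · simp only [ha, if_true, and_true, Finset.mul_sum]
          refine Finset.sum_congr rfl fun H _ => ?_
          split_ifs with hH
          · subst hH
            rw [Finset.mul_sum]
            refine Finset.sum_congr rfl fun V _ => ?_
            rw [mul_ite, mul_zero, mul_left_comm]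
          · simp
        · simp [ha]
      · rw [Finset.sum_comm]
        simp only [Finset.sum_comm (s := (Finset.univ : Finset (Fin m → Fin B)))]
        simp only [Finset.sum_ite_eq, Finset.mem_univ, if_true]
        rw [Finset.sum_comm]
        exact Finset.sum_congr rfl fun H _ => Finset.sum_comm
    · rw [sum_fin_snoc (m := c + 1)]
      refine Finset.sum_congr rfl fun H _ => ?_
      have h0 : ∀ h : Fin m → Fin B, Fin.snoc (α := fun _ => Fin m → Fin B) H h 0 = H 0 :=
        fun h => Fin.snoc_castSucc (α := fun _ => Fin m → Fin B) (i := 0) ..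
      conv_rhs => simp only [Fin.snoc_last, hE', ite_and, Finset.sum_ite_irrel,
        Finset.sum_const_zero, Finset.sum_ite_eq', Finset.mem_univ, if_true, h0]
      rw [sum_fin_snoc (m := c)]
      refine Finset.sum_congr rfl fun V _ => Finset.sum_congr rfl fun a _ => ?_
      simp only [Q, Fin.forall_fin_succ', Fin.prod_univ_castSucc, Fin.snoc_castSucc, Fin.snoc_last,
        Fin.val_castSucc, Fin.val_last, Fin.succ_castSucc, Fin.succ_last, hE, mul_assoc]

end

/-! ### Pipe puzzles as states of the lattice model -/

section
variable {K : Type*} [Field K]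

lemma InSn.inv_apply_lt {n : ℕ} {u : Equiv.Perm ℕ} (hu : InSn n u) {i : ℕ} (hi : i < n) :
    u⁻¹ i < n := by
  by_contra! h
  have := hu _ h
  simp only [Equiv.Perm.coe_inv, Equiv.apply_symm_apply] at this h
  omega

lemma ominus_eq_oplus (β a : K) {b : K} (hb : 1 + β * b ≠ 0) :
    ominus β a b = oplus β a (ominus β 0 b) := by
  unfold ominus oplus
  rw [div_eq_iff hb]
  linear_combination -(1 + β * a) * div_mul_cancel₀ (0 - b) hb

lemma stateWt_of_not_lAdm (β : K) {n k : ℕ} (t y : ℕ → K) {s : GridState n}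
    (h : ¬ ∀ i j : Fin n, LAdm k (labN s i j) (labE s i j) (labW s i j) (labS s i j)) :
    stateWt β k t y s = 0 := by
  push Not at h
  obtain ⟨i, j, h⟩ := h
  exact Finset.prod_eq_zero (Finset.mem_univ i)
    (Finset.prod_eq_zero (Finset.mem_univ j) (Lwt_of_not_lAdm _ _ h))

open Classical in
lemma finsum_stateWt_eq_sum (β : K) {n k : ℕ} (t y : ℕ → K) (u v w : Equiv.Perm ℕ) :
    ∑ᶠ π ∈ PP n k u v w, stateWt β k t y π =
      ∑ s : GridState n, if BoundaryCond n k u v w s then stateWt β k t y s else 0 := by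
  rw [finsum_mem_def, finsum_eq_sum_of_fintype]
  refine Finset.sum_congr rfl fun s _ => ?_
  rw [Set.indicator_apply]
  by_cases hb : BoundaryCond n k u v w s
  · by_cases ha : ∀ i j : Fin n, LAdm k (labN s i j) (labE s i j) (labW s i j) (labS s i j)
    · rw [if_pos ⟨hb, ha⟩, if_pos hb]
    · simp [stateWt_of_not_lAdm β t y ha]
  · rw [if_neg (fun h => hb h.1), if_neg hb]

lemma setCols_setRows_eq_iff {n k : ℕ} {u v w : Equiv.Perm ℕ} (hk : k ≤ n) (hu : InSn n u)
    (hv : InSn n v) (hw : InSn n w) (e a : Fin n → ℕ) :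
    setCols a (setRows e (Sum.elim (kappaLab k u) (thetaLab k v))) =
        Sum.elim (fun _ => 0) (etaLab w) ↔
      (∀ i, e i = 0) ∧ ∀ j, a j = etaLab w j := by
  constructor
  · intro h
    refine ⟨fun i => ?_, fun j => ?_⟩
    · simpa [setCols, setRows] using congrFun h (Sum.inl i)
    · simpa [setCols, setRows] using congrFun h (Sum.inr j)
  · rintro ⟨he, ha⟩
    ext (i | j)
    · simp only [setCols, setRows, Sum.elim_inl, Function.comp_apply]
      split_ifs with h
      · exact he _
      · rw [kappaLab, hu.inv _ (by omega), if_neg (by omega)]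
    · simp only [setCols, setRows, Sum.elim_inr, Function.comp_apply]
      split_ifs with h
      · exact ha _
      · rw [thetaLab, etaLab, hv.inv _ (by omega), hw.inv _ (by omega),
          if_pos (by omega)]

lemma puzzleSum_eq_finsum (β : K) {n k : ℕ} {u v w : Equiv.Perm ℕ} (hk : k ≤ n) (hu : InSn n u)
    (hv : InSn n v) (hw : InSn n w) (t : ℕ → K) {y : ℕ → K} (hy : ∀ j, 1 + β * y j ≠ 0) :
    puzzleSum β n k t (fun i => ominus β 0 (y i)) u v w =
      ∑ᶠ π ∈ PP n k u v w, stateWt β k t y π := by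
  classical
  rw [finsum_stateWt_eq_sum, puzzleSum, gridOp_eq_sum β k (n + 1), Fintype.sum_prod_type,
    ← (Equiv.piComm fun (_ : Fin n) (_ : Fin (n + 1)) => Fin (n + 1)).sum_comp]
  · refine Finset.sum_congr rfl fun H _ => ?_
    rw [← (Equiv.piComm fun (_ : Fin (n + 1)) (_ : Fin n) => Fin (n + 1)).sum_comp]
    refine Finset.sum_congr rfl fun V _ => ?_
    rw [target, setCols_setRows_eq_iff hk hu hv hw, mul_ite, mul_one, mul_zero]
    have hwt : ∏ j : Fin n, ∏ i : Fin n,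
        Lwt β k (oplus β (t j) (ominus β 0 (y i))) (V i.castSucc j) (H i j.succ) (H i j.castSucc)
          (V i.succ j) = stateWt β k t y (H, V) := by
      rw [stateWt, Finset.prod_comm]
      simp only [← ominus_eq_oplus β _ (hy _)]
      rfl
    simp only [Equiv.piComm_apply, Function.swap, Sum.elim_inl, Sum.elim_inr, hwt]
    by_cases hb : BoundaryCond n k u v w (H, V)
    · rw [if_pos hb, if_pos ⟨hb.2.1, hb.2.2.1⟩, if_pos ⟨hb.1, hb.2.2.2⟩]
    · rw [if_neg hb]
      split_ifs with hET hWS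
      · exact absurd ⟨hWS.1, hET.1, hET.2, hWS.2⟩ hb
      · rfl
      · rfl
  · intro i hi
    simp only [Sum.elim_inl, kappaLab]
    split_ifs <;> omega
  · intro j hj
    have := hv.inv_apply_lt hj
    simp only [Sum.elim_inr, thetaLab]
    split_ifs <;> omega

end

/-- Theorem `thm:mainTh` of the paper.  Let `u, v ∈ S_n` have
separated descents at position `k` and let `w ∈ S_n`.  Then the structure
constant `c_{u,v}^w(t, y)` equals the weighted sum over all pipe puzzles for
`(u, v, w)`. -/
theorem structure_constant_eq_pipe_puzzle_sum
    {K : Type*} [Field K] (β : K)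
    (G : (ℕ → K) → Equiv.Perm ℕ → MvPolynomial ℕ K)
    (c : (ℕ → K) → (ℕ → K) → Equiv.Perm ℕ → Equiv.Perm ℕ → Equiv.Perm ℕ → K)
    (hG : GrothFamily β G) (hc : StructConsts β G c)
    (n k : ℕ) (hk : k ≤ n)
    (u v w : Equiv.Perm ℕ) (hu : InSn n u) (hv : InSn n v) (hw : InSn n w)
    (hsep : SepDesc k u v)
    (t y : ℕ → K)
    (ht : ∀ j, 1 + β * t j ≠ 0) (hy : ∀ j, 1 + β * y j ≠ 0)
    (hLI : LinearIndependent K fun σ : {σ : Equiv.Perm ℕ // FinPerm σ} => G t σ.1) :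
    c t y u v w = ∑ᶠ π ∈ PP n k u v w, stateWt β k t y π := by
  rw [structConsts_eq_puzzleSum hG hc hk hu hv hw hsep ht hy,
    puzzleSum_eq_finsum β hk hu hv hw t hy]
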